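/- Existence and barriers for the stationary problem with constant boundary data: let f ∈ C(Ω̄) and m > 2, and set α = (m−2)/(m−1). For any R > 0 and 0 < λ < 1, there exists a unique continuous viscosity solution u_{R,λ} of the generalized Dirichlet problem S(Ω,f,k_R,λ) with constant boundary data k_R ≡ R on ∂Ω. Moreover, there exist constants M, K > 0 and δ₀ > 0, all independent of R and λ, such that −(sup|f|)/λ ≤ u_{R,λ}(x) ≤ K/λ for all x ∈ Ω, and u_{R,λ}(x) ≤ −(M/α)·d(x)^α + K/λ for all x ∈ Ω with d(x) ≤ δ₀. -/

import Mathlib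

open Set Filter Topology Metric MeasureTheory

noncomputable section

/-- Euclidean space `ℝ^N`. -/
abbrev Euc (N : ℕ) : Type := EuclideanSpace ℝ (Fin N)

/-- The Laplacian of `φ` at `x`, computed as the trace of the second derivative
in the standard orthonormal basis of `ℝ^N`. -/
noncomputable def lapl {N : ℕ} (φ : Euc N → ℝ) (x : Euc N) : ℝ :=
  ∑ i : Fin N,
    iteratedFDeriv ℝ 2 φ x ![EuclideanSpace.single i 1, EuclideanSpace.single i 1]

/-- `Ω` is a domain with `C²` boundary: it is the sublevel set of a `C²`
defining function whose gradient does not vanish on the boundary. -/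
def HasC2Boundary {N : ℕ} (Ω : Set (Euc N)) : Prop :=
  ∃ ρ : Euc N → ℝ, ContDiff ℝ 2 ρ ∧ Ω = {x | ρ x < 0} ∧
    frontier Ω = {x | ρ x = 0} ∧ ∀ x ∈ frontier Ω, gradient ρ x ≠ 0

/-- The stationary operator `−Δφ(x) + |Dφ(x)|^m + λ r − h(x)` evaluated with the
value `r` of the (sub/super)solution at `x`. -/
noncomputable def statOp {N : ℕ} (h : Euc N → ℝ) (lam m : ℝ)
    (φ : Euc N → ℝ) (r : ℝ) (x : Euc N) : ℝ :=
  -lapl φ x + ‖gradient φ x‖ ^ m + lam * r - h x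

/-- Viscosity subsolution of the generalized Dirichlet problem
`S(Ω,h,k,λ)`: `−Δw + |Dw|^m + λ w = h` in `Ω`, `w = k` on `∂Ω`. -/
def IsStatSub {N : ℕ} (Ω : Set (Euc N)) (h k : Euc N → ℝ) (lam m : ℝ)
    (u : Euc N → ℝ) : Prop :=
  UpperSemicontinuousOn u (closure Ω) ∧
  ∀ φ : Euc N → ℝ, ContDiff ℝ 2 φ → ∀ x₀ ∈ closure Ω,
    IsLocalMaxOn (u - φ) (closure Ω) x₀ →
      (x₀ ∈ Ω → statOp h lam m φ (u x₀) x₀ ≤ 0) ∧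
      (x₀ ∈ frontier Ω → min (statOp h lam m φ (u x₀) x₀) (u x₀ - k x₀) ≤ 0)

/-- Viscosity supersolution of the generalized Dirichlet problem `S(Ω,h,k,λ)`. -/
def IsStatSuper {N : ℕ} (Ω : Set (Euc N)) (h k : Euc N → ℝ) (lam m : ℝ)
    (v : Euc N → ℝ) : Prop :=
  LowerSemicontinuousOn v (closure Ω) ∧
  ∀ φ : Euc N → ℝ, ContDiff ℝ 2 φ → ∀ x₀ ∈ closure Ω,
    IsLocalMinOn (v - φ) (closure Ω) x₀ →
      (x₀ ∈ Ω → 0 ≤ statOp h lam m φ (v x₀) x₀) ∧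
      (x₀ ∈ frontier Ω → 0 ≤ max (statOp h lam m φ (v x₀) x₀) (v x₀ - k x₀))

/-- The parabolic operator
`φ_t(x,t) − Δφ(·,t)(x) + |Dφ(·,t)(x)|^m + λ r − f(x)`. -/
noncomputable def parOp {N : ℕ} (f : Euc N → ℝ) (lam m : ℝ)
    (φ : Euc N × ℝ → ℝ) (r : ℝ) (x : Euc N) (t : ℝ) : ℝ :=
  deriv (fun s => φ (x, s)) t - lapl (fun y => φ (y, t)) x
    + ‖gradient (fun y => φ (y, t)) x‖ ^ m + lam * r - f x

/-- Viscosity subsolution of the generalized initial-boundary value problem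
`E(Ω,f,g,u₀,λ)` on the time interval `[0,T]`:
`u_t − Δu + |Du|^m + λ u = f` in `Ω × (0,T]`, `u = g` on `∂Ω × (0,T]`,
`u(·,0) = u₀` on `closure Ω`. -/
def IsParSub {N : ℕ} (Ω : Set (Euc N)) (f g u₀ : Euc N → ℝ) (lam m T : ℝ)
    (u : Euc N → ℝ → ℝ) : Prop :=
  UpperSemicontinuousOn (fun p : Euc N × ℝ => u p.1 p.2) (closure Ω ×ˢ Ico 0 T) ∧
  (∀ x ∈ closure Ω, u x 0 ≤ u₀ x) ∧
  ∀ φ : Euc N × ℝ → ℝ, ContDiff ℝ 2 φ → ∀ x₀ : Euc N, ∀ t₀ : ℝ,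
    (x₀, t₀) ∈ closure Ω ×ˢ Ioc 0 T →
    IsLocalMaxOn (fun p : Euc N × ℝ => u p.1 p.2 - φ p) (closure Ω ×ˢ Ioc 0 T) (x₀, t₀) →
      (x₀ ∈ Ω → parOp f lam m φ (u x₀ t₀) x₀ t₀ ≤ 0) ∧
      (x₀ ∈ frontier Ω →
        min (parOp f lam m φ (u x₀ t₀) x₀ t₀) (u x₀ t₀ - g x₀) ≤ 0)

/-- Viscosity supersolution of `E(Ω,f,g,u₀,λ)` on the time interval `[0,T]`. -/
def IsParSuper {N : ℕ} (Ω : Set (Euc N)) (f g u₀ : Euc N → ℝ) (lam m T : ℝ)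
    (v : Euc N → ℝ → ℝ) : Prop :=
  LowerSemicontinuousOn (fun p : Euc N × ℝ => v p.1 p.2) (closure Ω ×ˢ Icc 0 T) ∧
  (∀ x ∈ closure Ω, u₀ x ≤ v x 0) ∧
  ∀ φ : Euc N × ℝ → ℝ, ContDiff ℝ 2 φ → ∀ x₀ : Euc N, ∀ t₀ : ℝ,
    (x₀, t₀) ∈ closure Ω ×ˢ Ioc 0 T →
    IsLocalMinOn (fun p : Euc N × ℝ => v p.1 p.2 - φ p) (closure Ω ×ˢ Ioc 0 T) (x₀, t₀) →
      (x₀ ∈ Ω → 0 ≤ parOp f lam m φ (v x₀ t₀) x₀ t₀) ∧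
      (x₀ ∈ frontier Ω →
        0 ≤ max (parOp f lam m φ (v x₀ t₀) x₀ t₀) (v x₀ t₀ - g x₀))

/-- A continuous viscosity solution, global in time, of `E(Ω,f,g,u₀,λ)`. -/
def IsGlobalParSol {N : ℕ} (Ω : Set (Euc N)) (f g u₀ : Euc N → ℝ) (lam m : ℝ)
    (u : Euc N → ℝ → ℝ) : Prop :=
  ContinuousOn (fun p : Euc N × ℝ => u p.1 p.2) (closure Ω ×ˢ Ici 0) ∧
  ∀ T > (0 : ℝ), IsParSub Ω f g u₀ lam m T u ∧ IsParSuper Ω f g u₀ lam m T u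

open scoped Classical in
/-- Redefinition of a parabolic subsolution on the lateral boundary by its
`limsup` from inside `Ω × (0,T]`. -/
noncomputable def uscExtPar {N : ℕ} (Ω : Set (Euc N)) (T : ℝ)
    (u : Euc N → ℝ → ℝ) : Euc N → ℝ → ℝ :=
  fun z t => if z ∈ Ω then u z t
    else limsup (fun p : Euc N × ℝ => u p.1 p.2) (𝓝[Ω ×ˢ Ioc 0 T] (z, t))

open scoped Classical in
/-- Redefinition of a stationary subsolution on the boundary by its `limsup`
from inside `Ω`. -/
noncomputable def uscExtStat {N : ℕ} (Ω : Set (Euc N))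
    (u : Euc N → ℝ) : Euc N → ℝ :=
  fun z => if z ∈ Ω then u z else limsup u (𝓝[Ω] z)

/-- Continuous viscosity solution of the state constraint problem
`−Δw + |Dw|^m + λ w = h` in `Ω`, `−Δw + |Dw|^m + λ w ≥ h` on `∂Ω`. -/
def IsSCSolution {N : ℕ} (Ω : Set (Euc N)) (h : Euc N → ℝ) (lam m : ℝ)
    (w : Euc N → ℝ) : Prop :=
  ContinuousOn w (closure Ω) ∧
  (∀ φ : Euc N → ℝ, ContDiff ℝ 2 φ → ∀ x₀ ∈ Ω, IsLocalMaxOn (w - φ) Ω x₀ →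
      statOp h lam m φ (w x₀) x₀ ≤ 0) ∧
  (∀ φ : Euc N → ℝ, ContDiff ℝ 2 φ → ∀ x₀ ∈ closure Ω,
      IsLocalMinOn (w - φ) (closure Ω) x₀ → 0 ≤ statOp h lam m φ (w x₀) x₀)

/-- Continuous viscosity subsolution of `−Δu + |Du|^m ≤ h` in `Ω`
(no boundary condition). -/
def IsIntSub {N : ℕ} (Ω : Set (Euc N)) (h : Euc N → ℝ) (m : ℝ)
    (u : Euc N → ℝ) : Prop :=
  ∀ φ : Euc N → ℝ, ContDiff ℝ 2 φ → ∀ x₀ ∈ Ω, IsLocalMaxOn (u - φ) Ω x₀ →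
    statOp h 0 m φ (u x₀) x₀ ≤ 0

/-- Hölder continuity with exponent `α` on a set. -/
def HolderOnCl {N : ℕ} (α : ℝ) (s : Set (Euc N)) (w : Euc N → ℝ) : Prop :=
  ∃ C > (0 : ℝ), ∀ x ∈ s, ∀ y ∈ s, |w x - w y| ≤ C * ‖x - y‖ ^ α

/-- Local Lipschitz continuity inside `Ω`. -/
def LocLipIn {N : ℕ} (Ω : Set (Euc N)) (w : Euc N → ℝ) : Prop :=
  ∀ x ∈ Ω, ∃ ε > (0 : ℝ), ∃ K : ℝ, 0 ≤ K ∧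
    ∀ y ∈ ball x ε ∩ Ω, ∀ z ∈ ball x ε ∩ Ω, |w y - w z| ≤ K * ‖y - z‖

/-- A piecewise `C¹` path parametrized on `[0,1]`. -/
def IsPWC1Path {N : ℕ} (γ : ℝ → Euc N) : Prop :=
  ContinuousOn γ (Icc 0 1) ∧
  ∃ n : ℕ, ∃ τ : Fin (n + 1) → ℝ, StrictMono τ ∧ τ 0 = 0 ∧ τ (Fin.last n) = 1 ∧
    ∀ i : Fin n, ContDiffOn ℝ 1 γ (Icc (τ i.castSucc) (τ i.succ))

/-- The length of a path on `[0,1]`. -/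
noncomputable def pathLen {N : ℕ} (γ : ℝ → Euc N) : ℝ :=
  ∫ t in (0 : ℝ)..1, ‖derivWithin γ (Icc (0 : ℝ) 1) t‖

/-- The geodesic-type distance inside `closure S` via piecewise `C¹` paths. -/
noncomputable def dTilde {N : ℕ} (S : Set (Euc N)) (x y : Euc N) : ℝ :=
  sInf {L : ℝ | ∃ γ : ℝ → Euc N, IsPWC1Path γ ∧ γ 0 = x ∧ γ 1 = y ∧
    MapsTo γ (Icc 0 1) (closure S) ∧ L = pathLen γ}

/-- The inner parallel set `Ω_δ = {x ∈ Ω : dist(x,∂Ω) > δ}`. -/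
def innerSet {N : ℕ} (Ω : Set (Euc N)) (δ : ℝ) : Set (Euc N) :=
  {x ∈ Ω | δ < infDist x (frontier Ω)}

end

section Calculus

variable {N : ℕ}

lemma lapl_eq_sum_fderiv (φ : Euc N → ℝ) (x : Euc N) :
    lapl φ x = ∑ i : Fin N, fderiv ℝ (fderiv ℝ φ) x (EuclideanSpace.single i 1)
      (EuclideanSpace.single i 1) := by
  simp [lapl, iteratedFDeriv_two_apply]

lemma lapl_eq_laplacian (φ : Euc N → ℝ) : lapl φ = Laplacian.laplacian φ := by
  rw [InnerProductSpace.laplacian_eq_iteratedFDeriv_orthonormalBasis φ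
    (EuclideanSpace.basisFun (Fin N) ℝ)]
  funext x
  simp [lapl]

lemma lapl_congr {φ ψ : Euc N → ℝ} {x : Euc N} (h : φ =ᶠ[𝓝 x] ψ) : lapl φ x = lapl ψ x := by
  simp only [lapl_eq_laplacian]
  exact (InnerProductSpace.laplacian_congr_nhds h).eq_of_nhds

lemma gradient_congr {φ ψ : Euc N → ℝ} {x : Euc N} (h : φ =ᶠ[𝓝 x] ψ) :
    gradient φ x = gradient ψ x := by
  simp only [gradient, h.fderiv_eq]

lemma statOp_congr {h : Euc N → ℝ} {lam m r : ℝ} {φ ψ : Euc N → ℝ} {x : Euc N}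
    (e : φ =ᶠ[𝓝 x] ψ) : statOp h lam m φ r x = statOp h lam m ψ r x := by
  simp only [statOp, lapl_congr e, gradient_congr e]

lemma lapl_add {φ ψ : Euc N → ℝ} {x : Euc N} (h₁ : ContDiffAt ℝ 2 φ x) (h₂ : ContDiffAt ℝ 2 ψ x) :
    lapl (fun y => φ y + ψ y) x = lapl φ x + lapl ψ x := by
  simp only [lapl_eq_laplacian]
  exact h₁.laplacian_add h₂

lemma lapl_sub {φ ψ : Euc N → ℝ} {x : Euc N} (h₁ : ContDiffAt ℝ 2 φ x) (h₂ : ContDiffAt ℝ 2 ψ x) :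
    lapl (fun y => φ y - ψ y) x = lapl φ x - lapl ψ x := by
  simp only [lapl_eq_laplacian]
  exact h₁.laplacian_sub h₂

lemma lapl_const_mul {φ : Euc N → ℝ} {x : Euc N} (c : ℝ) (h₁ : ContDiffAt ℝ 2 φ x) :
    lapl (fun y => c * φ y) x = c * lapl φ x := by
  simp only [lapl_eq_laplacian]
  exact InnerProductSpace.laplacian_smul c h₁

lemma lapl_const (c : ℝ) (x : Euc N) : lapl (fun _ : Euc N => c) x = 0 := by
  simp [lapl_eq_sum_fderiv]

lemma inner_gradient (φ : Euc N → ℝ) (x v : Euc N) :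
    inner ℝ (gradient φ x) v = fderiv ℝ φ x v := by
  simp [gradient]

lemma gradient_add {φ ψ : Euc N → ℝ} {x : Euc N} (h₁ : ContDiffAt ℝ 2 φ x)
    (h₂ : ContDiffAt ℝ 2 ψ x) :
    gradient (fun y => φ y + ψ y) x = gradient φ x + gradient ψ x := by
  simp only [gradient]
  rw [fderiv_fun_add (h₁.differentiableAt (by norm_num)) (h₂.differentiableAt (by norm_num)),
    map_add]

lemma gradient_sub {φ ψ : Euc N → ℝ} {x : Euc N} (h₁ : ContDiffAt ℝ 2 φ x)
    (h₂ : ContDiffAt ℝ 2 ψ x) :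
    gradient (fun y => φ y - ψ y) x = gradient φ x - gradient ψ x := by
  simp only [gradient]
  rw [fderiv_fun_sub (h₁.differentiableAt (by norm_num)) (h₂.differentiableAt (by norm_num)),
    map_sub]

lemma gradient_const_mul {φ : Euc N → ℝ} {x : Euc N} (c : ℝ) (h₁ : ContDiffAt ℝ 2 φ x) :
    gradient (fun y => c * φ y) x = c • gradient φ x := by
  simp only [gradient]
  rw [fderiv_const_mul (h₁.differentiableAt (by norm_num)), map_smul]

lemma sum_fderiv_sq (φ : Euc N → ℝ) (x : Euc N) :
    ∑ i : Fin N, (fderiv ℝ φ x (EuclideanSpace.single i 1)) ^ 2 = ‖gradient φ x‖ ^ 2 := by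
  rw [EuclideanSpace.norm_sq_eq]
  refine Finset.sum_congr rfl fun i _ => ?_
  rw [← inner_gradient, EuclideanSpace.inner_single_right]
  simp

lemma gradient_comp {F : ℝ → ℝ} {s : Euc N → ℝ} {x : Euc N} {c : ℝ}
    (hs : ContDiffAt ℝ 2 s x) (hF : HasDerivAt F c (s x)) :
    gradient (fun y => F (s y)) x = c • gradient s x := by
  have h := hF.comp_hasFDerivAt x (hs.differentiableAt (by norm_num)).hasFDerivAt
  simp only [gradient]
  rw [show (fun y => F (s y)) = F ∘ s from rfl, h.fderiv, map_smul]

lemma lapl_comp {F F' : ℝ → ℝ} {s : Euc N → ℝ} {x : Euc N} {c : ℝ}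
    (hs : ContDiffAt ℝ 2 s x) (hF : ∀ᶠ y in 𝓝 (s x), HasDerivAt F (F' y) y)
    (hF' : HasDerivAt F' c (s x)) :
    lapl (fun y => F (s y)) x = c * ‖gradient s x‖ ^ 2 + F' (s x) * lapl s x := by
  have hd : ∀ᶠ y in 𝓝 x, DifferentiableAt ℝ s y := by
    filter_upwards [hs.eventually (by norm_num)] with y hy
    exact hy.differentiableAt (by norm_num)
  have h1 : fderiv ℝ (fun y => F (s y)) =ᶠ[𝓝 x] fun y => F' (s y) • fderiv ℝ s y := by
    filter_upwards [hd, hs.continuousAt.eventually hF] with y hy hy'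
    exact (hy'.comp_hasFDerivAt y hy.hasFDerivAt).fderiv
  have h2 : HasFDerivAt (fun y => F' (s y)) (c • fderiv ℝ s x) x :=
    hF'.comp_hasFDerivAt x hd.self_of_nhds.hasFDerivAt
  have h3 : HasFDerivAt (fderiv ℝ s) (fderiv ℝ (fderiv ℝ s) x) x :=
    ((hs.fderiv_right (m := 1) (by norm_num)).differentiableAt (by norm_num)).hasFDerivAt
  have h4 : HasFDerivAt (fun y => F' (s y) • fderiv ℝ s y) _ x := h2.smul h3
  rw [lapl_eq_sum_fderiv, h1.fderiv_eq, h4.fderiv, lapl_eq_sum_fderiv, ← sum_fderiv_sq,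
    Finset.mul_sum, Finset.mul_sum, ← Finset.sum_add_distrib]
  refine Finset.sum_congr rfl fun i _ => ?_
  simp
  ring

lemma contDiff_normSq (y : Euc N) : ContDiff ℝ 2 fun x : Euc N => ‖x - y‖ ^ 2 :=
  (contDiff_id.sub contDiff_const).norm_sq ℝ

lemma hasFDerivAt_normSq (y x : Euc N) :
    HasFDerivAt (fun x : Euc N => ‖x - y‖ ^ 2) (2 • innerSL ℝ (x - y)) x := by
  exact (hasStrictFDerivAt_norm_sq (x - y)).hasFDerivAt.comp x ((hasFDerivAt_id x).sub_const y)

lemma gradient_normSq (y x : Euc N) :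
    gradient (fun x : Euc N => ‖x - y‖ ^ 2) x = (2 : ℝ) • (x - y) := by
  refine ext_inner_right ℝ fun v => ?_
  rw [inner_gradient, (hasFDerivAt_normSq y x).fderiv]
  simp [inner_smul_left, inner_sub_left]

lemma lapl_normSq (y x : Euc N) : lapl (fun x : Euc N => ‖x - y‖ ^ 2) x = 2 * N := by
  have h1 : fderiv ℝ (fun x : Euc N => ‖x - y‖ ^ 2) = fun x => 2 • innerSL ℝ (x - y) :=
    funext fun x => (hasFDerivAt_normSq y x).fderiv
  have h2 : HasFDerivAt (fun x : Euc N => 2 • innerSL ℝ (x - y)) (2 • innerSL ℝ (E := Euc N)) x := by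
    exact (((innerSL ℝ (E := Euc N)).hasFDerivAt (x := x - y)).comp x
      ((hasFDerivAt_id x).sub_const y)).const_smul (2 : ℕ)
  rw [lapl_eq_sum_fderiv, h1, h2.fderiv]
  have h3 : ∀ i : Fin N, (2 • innerSL ℝ (E := Euc N)) (EuclideanSpace.single i 1)
      (EuclideanSpace.single i 1) = 2 := fun i => by
    change (2 : ℕ) • inner ℝ (EuclideanSpace.single i (1 : ℝ)) (EuclideanSpace.single i (1 : ℝ)) = _
    simp
  simp only [h3]
  simp [mul_comm]

lemma continuousAt_lapl {φ : Euc N → ℝ} {x : Euc N} (h : ContDiffAt ℝ 2 φ x) :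
    ContinuousAt (lapl φ) x := by
  have h3 : ContinuousAt (fderiv ℝ (fderiv ℝ φ)) x :=
    ((h.fderiv_right (m := 1) (by norm_num)).fderiv_right (m := 0) (by norm_num)).continuousAt
  rw [funext (lapl_eq_sum_fderiv φ)]
  exact tendsto_finsetSum _ fun i _ => (h3.clm_apply continuousAt_const).clm_apply continuousAt_const

lemma continuousAt_gradient {φ : Euc N → ℝ} {x : Euc N} (h : ContDiffAt ℝ 2 φ x) :
    ContinuousAt (gradient φ) x := by
  have h3 : ContinuousAt (fderiv ℝ φ) x := (h.fderiv_right (m := 1) (by norm_num)).continuousAt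
  exact (InnerProductSpace.toDual ℝ (Euc N)).symm.continuous.continuousAt.comp h3

/-- The part of the stationary operator that does not involve the unknown. -/
noncomputable def eikOp (m : ℝ) (φ : Euc N → ℝ) (x : Euc N) : ℝ :=
  -lapl φ x + ‖gradient φ x‖ ^ m

lemma continuousAt_eikOp {m : ℝ} (hm : 0 ≤ m) {φ : Euc N → ℝ} {x : Euc N}
    (h : ContDiffAt ℝ 2 φ x) : ContinuousAt (eikOp m φ) x :=
  (continuousAt_lapl h).neg.add ((continuousAt_gradient h).norm.rpow_const (Or.inr hm))

lemma statOp_eq (h : Euc N → ℝ) (lam m r : ℝ) (φ : Euc N → ℝ) (x : Euc N) :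
    statOp h lam m φ r x = eikOp m φ x + lam * r - h x := rfl

lemma gradient_eq_of_isLocalMax_sub {φ ψ : Euc N → ℝ} {x : Euc N} (h₁ : ContDiffAt ℝ 2 φ x)
    (h₂ : ContDiffAt ℝ 2 ψ x) (h : IsLocalMax (fun y => φ y - ψ y) x) :
    gradient φ x = gradient ψ x := by
  have := h.fderiv_eq_zero
  rw [← sub_eq_zero, ← gradient_sub h₁ h₂]
  simp [gradient, this]

/-- At a local maximum every pure second derivative is nonpositive. -/
lemma deriv_deriv_nonpos_of_isLocalMax {g : ℝ → ℝ} (hg : ContDiffAt ℝ 2 g 0)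
    (h : IsLocalMax g 0) : deriv (deriv g) 0 ≤ 0 := by
  by_contra! hpos
  have h0 : deriv g 0 = 0 := h.deriv_eq_zero
  have hmin := isLocalMin_of_deriv_deriv_pos hpos h0 hg.continuousAt
  have hc : g =ᶠ[𝓝 0] fun _ => g 0 := by
    filter_upwards [h, hmin] with y h1 h2 using le_antisymm h1 h2
  have : deriv (deriv g) 0 = 0 := by
    rw [hc.deriv.deriv_eq]
    simp
  linarith

lemma lapl_nonpos_of_isLocalMax {φ : Euc N → ℝ} {x : Euc N} (h₁ : ContDiffAt ℝ 2 φ x)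
    (h : IsLocalMax φ x) : lapl φ x ≤ 0 := by
  rw [lapl_eq_sum_fderiv]
  refine Finset.sum_nonpos fun i _ => ?_
  set v : Euc N := EuclideanSpace.single i 1
  have hl : ∀ t : ℝ, HasDerivAt (fun t : ℝ => x + t • v) v t := fun t => by
    simpa using ((hasDerivAt_id t).smul_const v).const_add x
  have hc : ContinuousAt (fun t : ℝ => x + t • v) 0 := (hl 0).continuousAt
  have hx : x + (0 : ℝ) • v = x := by simp
  have ht : Tendsto (fun t : ℝ => x + t • v) (𝓝 0) (𝓝 x) := by
    have := hc.tendsto; rwa [hx] at this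
  have h₁' : ContDiffAt ℝ 2 φ (x + (0 : ℝ) • v) := by rwa [hx]
  have hg : ContDiffAt ℝ 2 (fun t : ℝ => φ (x + t • v)) 0 :=
    h₁'.comp (0 : ℝ) (by fun_prop : ContDiffAt ℝ 2 (fun t : ℝ => x + t • v) 0)
  have hd : deriv (fun t : ℝ => φ (x + t • v)) =ᶠ[𝓝 0] fun t => fderiv ℝ φ (x + t • v) v := by
    filter_upwards [ht.eventually (h₁.eventually (by norm_num))] with t hφ
    exact ((hφ.differentiableAt (by norm_num)).hasFDerivAt.comp_hasDerivAt t (hl t)).deriv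
  have hmax : IsLocalMax (fun t : ℝ => φ (x + t • v)) 0 := by
    have := ht.eventually h
    filter_upwards [this] with t ht'
    simpa using ht'
  have h3 : HasFDerivAt (fderiv ℝ φ) (fderiv ℝ (fderiv ℝ φ) x) (x + (0 : ℝ) • v) := by
    rw [hx]
    exact ((h₁.fderiv_right (m := 1) (by norm_num)).differentiableAt (by norm_num)).hasFDerivAt
  have h4 : HasDerivAt (fun t : ℝ => fderiv ℝ φ (x + t • v) v) (fderiv ℝ (fderiv ℝ φ) x v v) 0 := by
    exact (ContinuousLinearMap.apply ℝ ℝ v).hasFDerivAt.comp_hasDerivAt (0 : ℝ)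
      (h3.comp_hasDerivAt (0 : ℝ) (hl 0))
  have := deriv_deriv_nonpos_of_isLocalMax hg hmax
  rwa [hd.deriv_eq, h4.deriv] at this

/-- Comparison of the second order operator at a touching point. -/
lemma eikOp_le_of_isLocalMax_sub {m : ℝ} {φ ψ : Euc N → ℝ} {x : Euc N} (h₁ : ContDiffAt ℝ 2 φ x)
    (h₂ : ContDiffAt ℝ 2 ψ x) (h : IsLocalMax (fun y => φ y - ψ y) x) :
    eikOp m ψ x ≤ eikOp m φ x := by
  have := lapl_nonpos_of_isLocalMax (h₁.sub h₂) h
  rw [lapl_sub h₁ h₂] at this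
  simp only [eikOp, gradient_eq_of_isLocalMax_sub h₁ h₂ h]
  linarith

/-- A function that is `C²` at a point agrees near that point with a globally `C²` function. -/
lemma exists_contDiff_eventuallyEq {φ : Euc N → ℝ} {x : Euc N} (h : ContDiffAt ℝ 2 φ x) :
    ∃ ψ : Euc N → ℝ, ContDiff ℝ 2 ψ ∧ ψ =ᶠ[𝓝 x] φ := by
  obtain ⟨r, hr, hφ⟩ : ∃ r > 0, ∀ y ∈ ball x r, ContDiffAt ℝ 2 φ y :=
    Metric.eventually_nhds_iff_ball.1 (h.eventually (by norm_num))
  let b : ContDiffBump x := ⟨r / 4, r / 2, by positivity, by linarith⟩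
  refine ⟨fun y => b y * φ y, contDiff_iff_contDiffAt.2 fun y => ?_, ?_⟩
  · by_cases hy : y ∈ ball x r
    · exact b.contDiffAt.mul (hφ y hy)
    · have : (fun y => b y * φ y) =ᶠ[𝓝 y] fun _ => 0 := by
        have hy' : y ∈ (closedBall x (r / 2))ᶜ := by
          simp only [mem_compl_iff, mem_closedBall, mem_ball, not_le, not_lt] at hy ⊢
          linarith
        filter_upwards [isClosed_closedBall.isOpen_compl.mem_nhds hy'] with z hz
        rw [b.zero_of_le_dist (by simpa using (by simpa using hz : r / 2 < dist z x).le), zero_mul]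
      exact contDiffAt_const.congr_of_eventuallyEq this
  · filter_upwards [b.eventuallyEq_one] with y hy
    simp [hy]

end Calculus

section Resolvent

variable {N : ℕ}

open scoped SchwartzMap Laplacian FourierTransform ContDiff

lemma hasTemperateGrowth_inv_one_add (c : ℝ) (hc : 0 ≤ c) :
    (fun v : Euc N => (1 + c * ‖v‖ ^ 2)⁻¹).HasTemperateGrowth := by
  have h := (Function.hasTemperateGrowth_one_add_norm_sq_rpow (Euc N) (-1)).comp
    ((Real.sqrt c) • ContinuousLinearMap.id ℝ (Euc N)).hasTemperateGrowth
  have e : (fun v : Euc N => (1 + c * ‖v‖ ^ 2)⁻¹) = (fun x : Euc N => (1 + ‖x‖ ^ 2) ^ (-1 : ℝ)) ∘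
      ⇑(Real.sqrt c • ContinuousLinearMap.id ℝ (Euc N)) := by
    funext v
    simp only [Function.comp_apply, Real.rpow_neg_one]
    congr 2
    simp [norm_smul, mul_pow, Real.sq_sqrt hc]
  rw [e]
  exact h

lemma exists_schwartz_resolvent {t : ℝ} (ht : 0 < t) (p : 𝓢(Euc N, ℂ)) :
    ∃ W : 𝓢(Euc N, ℂ), W - t • Δ W = p := by
  set c := t * (2 * Real.pi) ^ 2
  have hc : 0 ≤ c := by positivity
  have hg := hasTemperateGrowth_inv_one_add (N := N) c hc
  refine ⟨SchwartzMap.fourierMultiplierCLM ℂ (fun v : Euc N => (1 + c * ‖v‖ ^ 2)⁻¹) p, ?_⟩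
  rw [SchwartzMap.laplacian_eq_fourierMultiplierCLM,
    SchwartzMap.fourierMultiplierCLM_fourierMultiplierCLM_apply (by fun_prop) hg,
    SchwartzMap.fourierMultiplierCLM_apply, SchwartzMap.fourierMultiplierCLM_apply, smul_smul,
    ← FourierTransform.fourierInv_smul, sub_eq_add_neg, ← neg_one_smul ℝ (𝓕⁻ _),
    ← FourierTransform.fourierInv_smul, ← FourierTransform.fourierInv_add, neg_one_smul,
    ← sub_eq_add_neg]
  conv_rhs => rw [← FourierTransform.fourierInv_fourier_eq (F := 𝓢(Euc N, ℂ)) p]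
  congr 1
  ext v
  have h2 : ((fun x : Euc N => ‖x‖ ^ 2) * fun v => (1 + c * ‖v‖ ^ 2)⁻¹).HasTemperateGrowth :=
    Function.HasTemperateGrowth.mul (by fun_prop) hg
  rw [_root_.sub_apply, _root_.smul_apply, SchwartzMap.smulLeftCLM_apply_apply hg,
    SchwartzMap.smulLeftCLM_apply_apply h2, smul_smul, ← sub_smul]
  have : (1 + c * ‖v‖ ^ 2)⁻¹ - t * -(2 * Real.pi) ^ 2 *
      (‖v‖ ^ 2 * (1 + c * ‖v‖ ^ 2)⁻¹) = 1 := by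
    have : 1 + c * ‖v‖ ^ 2 ≠ 0 := by positivity
    field_simp
    simp only [c]
    ring
  rw [Pi.mul_apply, this, one_smul]

lemma exists_real_resolvent {t : ℝ} (ht : 0 < t) {p : Euc N → ℝ} (hp : ContDiff ℝ ∞ p)
    (hc : HasCompactSupport p) :
    ∃ W : 𝓢(Euc N, ℝ), ∀ x, W x - t * lapl W x = p x := by
  have h1 : ContDiff ℝ ∞ (fun x => (p x : ℂ)) := Complex.ofRealCLM.contDiff.comp hp
  have h2 : HasCompactSupport (fun x => (p x : ℂ)) := hc.comp_left (g := Complex.ofReal) (by simp)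
  obtain ⟨W, hW⟩ := exists_schwartz_resolvent ht (h2.toSchwartzMap h1)
  refine ⟨W.postcompCLM Complex.reCLM, fun x => ?_⟩
  have h3 := congrArg (fun q : 𝓢(Euc N, ℂ) => (q x).re) hW
  simp only [_root_.sub_apply, _root_.smul_apply, SchwartzMap.laplacian_apply] at h3
  have h4 : Δ (Complex.reCLM ∘ (W : Euc N → ℂ)) x = Complex.reCLM (Δ (W : Euc N → ℂ) x) :=
    ContDiffAt.laplacian_CLM_comp_left (W.smooth 2).contDiffAt
  rw [lapl_eq_laplacian]
  change (W x).re - t * Δ (Complex.reCLM ∘ (W : Euc N → ℂ)) x = p x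
  rw [h4]
  simpa using h3

lemma resolvent_le {t C : ℝ} (ht : 0 < t) {p : Euc N → ℝ} {W : 𝓢(Euc N, ℝ)}
    (hW : ∀ x, W x - t * lapl W x = p x) (hC : 0 ≤ C) (hp : ∀ x, p x ≤ C) (x : Euc N) :
    W x ≤ C := by
  by_contra! h
  have h0 : Tendsto W (cocompact (Euc N)) (𝓝 0) := zero_at_infty W
  obtain ⟨y, hy⟩ := W.continuous.exists_forall_ge' x
    ((h0.eventually (gt_mem_nhds (hC.trans_lt h))).mono fun z hz => hz.le)
  have h1 := lapl_nonpos_of_isLocalMax (W.smooth 2).contDiffAt (Filter.Eventually.of_forall hy)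
  have h2 := hW y
  nlinarith [hp y, hy x]

lemma abs_resolvent_le {t C : ℝ} (ht : 0 < t) {p : Euc N → ℝ} {W : 𝓢(Euc N, ℝ)}
    (hW : ∀ x, W x - t * lapl W x = p x) (hC : 0 ≤ C) (hp : ∀ x, |p x| ≤ C) (x : Euc N) :
    |W x| ≤ C := by
  refine abs_le.2 ⟨?_, resolvent_le ht hW hC (fun x => (abs_le.1 (hp x)).2) x⟩
  have h := resolvent_le (W := -W) (p := fun x => - p x) ht (fun x => ?_) hC
    (fun x => by linarith [(abs_le.1 (hp x)).1]) x
  · rw [_root_.neg_apply] at h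
    linarith
  · have := hW x
    rw [lapl_eq_laplacian] at this ⊢
    have h2 : Δ (⇑(-W)) x = - Δ (⇑W) x := by
      have : (⇑(-W) : Euc N → ℝ) = -⇑W := by ext; simp
      rw [this, InnerProductSpace.laplacian_neg]; rfl
    rw [h2, _root_.neg_apply]
    linarith

lemma integral_mul_lapl_comm (φ ψ : 𝓢(Euc N, ℝ)) :
    ∫ x, φ x * lapl ψ x = ∫ x, lapl φ x * ψ x := by
  simpa only [lapl_eq_laplacian, ← SchwartzMap.laplacian_apply] using
    SchwartzMap.integral_mul_laplacian_right_eq_left (μ := volume) φ ψ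

end Resolvent

section Distributional

variable {N : ℕ}

open scoped SchwartzMap ContDiff

/-- Viscosity subsolution of `−Δz ≤ g` in `Ω`. -/
def LapSub (Ω : Set (Euc N)) (g z : Euc N → ℝ) : Prop :=
  ∀ φ : Euc N → ℝ, ContDiff ℝ 2 φ → ∀ x ∈ Ω, IsLocalMax (fun y => z y - φ y) x → -lapl φ x ≤ g x

lemma contDiff_quartic (a : ℝ) (x₀ : Euc N) : ContDiff ℝ 2 fun x : Euc N => a * (‖x - x₀‖ ^ 2) ^ 2 :=
  contDiff_const.mul ((contDiff_normSq x₀).pow 2)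

lemma lapl_quartic (a : ℝ) (x₀ x : Euc N) :
    lapl (fun x : Euc N => a * (‖x - x₀‖ ^ 2) ^ 2) x = a * (8 + 4 * N) * ‖x - x₀‖ ^ 2 := by
  rw [lapl_comp (F := fun s => a * s ^ 2) (F' := fun s => a * (2 * s)) (c := a * 2)
    (contDiff_normSq x₀).contDiffAt, gradient_normSq, lapl_normSq, norm_smul]
  · norm_num
    ring
  · refine Filter.Eventually.of_forall fun s => ?_
    simpa using (hasDerivAt_pow 2 s).const_mul a
  · simpa using ((hasDerivAt_id (‖x - x₀‖ ^ 2)).const_mul 2).const_mul a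

lemma LapSub.le_resolvent {Ω S : Set (Euc N)} (hΩ : IsOpen Ω) {g z : Euc N → ℝ} (hz : Continuous z)
    (hg : Continuous g) (hgc : HasCompactSupport g) {L : ℝ} (hL : ∀ x, |z x| ≤ L)
    (h : LapSub Ω g z) (hS : IsCompact S) (hSΩ : S ⊆ Ω) {ε : ℝ} (hε : 0 < ε) :
    ∃ t₀ > 0, ∀ t, 0 < t → t < t₀ → ∀ (p : Euc N → ℝ) (W : 𝓢(Euc N, ℝ)),
      (∀ x, W x - t * lapl W x = p x) → (∀ x, |p x - z x| ≤ t ^ 2) →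
      ∀ x ∈ S, z x ≤ W x + t ^ 2 + t * (g x + ε) := by
  obtain ⟨r, hr, hrS⟩ := hS.exists_cthickening_subset_open hΩ hSΩ
  obtain ⟨B, hB⟩ := hg.bounded_above_of_compact_support hgc
  have hL0 : 0 ≤ L := (abs_nonneg _).trans (hL 0)
  have hB0 : 0 ≤ B := (norm_nonneg _).trans (hB 0)
  set a := (4 * L + 4) / r ^ 4 with ha
  have ha0 : 0 < a := by positivity
  set C := a * (8 + 4 * N) with hC
  have hC0 : 0 < C := by positivity
  obtain ⟨η₁, hη₁, hgη⟩ := Metric.uniformContinuous_iff.1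
    (hgc.uniformContinuous_of_continuous hg) (ε / 2) (by positivity)
  obtain ⟨η₂, hη₂, hη₂'⟩ : ∃ η₂ > 0, C * η₂ ^ 2 ≤ ε / 2 := by
    refine ⟨Real.sqrt (ε / 2 / C), by positivity, ?_⟩
    rw [Real.sq_sqrt (by positivity)]
    field_simp
    rfl
  set η := min η₁ η₂
  have hη : 0 < η := lt_min hη₁ hη₂
  have hη2 : C * η ^ 2 ≤ ε / 2 := by
    refine le_trans ?_ hη₂'
    gcongr
    exact min_le_right _ _
  refine ⟨min 1 (a * η ^ 4 / (2 * B + C * r ^ 2 + 1)), by positivity, ?_⟩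
  intro t ht htt p W hW hp x₀ hx₀
  have ht1 : t < 1 := htt.trans_le (min_le_left _ _)
  have ht2 : t * (2 * B + C * r ^ 2 + 1) < a * η ^ 4 :=
    (lt_div_iff₀ (by positivity)).1 (htt.trans_le (min_le_right _ _))
  have ht3 : t ^ 2 ≤ 1 := by nlinarith
  have hWL : ∀ x, |W x| ≤ L + 1 := abs_resolvent_le ht hW (by positivity) fun x => by
    have h1 := abs_le.1 (hp x)
    have h2 := abs_le.1 (hL x)
    rw [abs_le]
    constructor <;> linarith
  set q : Euc N → ℝ := fun x => a * (‖x - x₀‖ ^ 2) ^ 2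
  have hq : ContDiff ℝ 2 q := contDiff_quartic a x₀
  obtain ⟨y, hy, hmax⟩ := (isCompact_closedBall x₀ r).exists_isMaxOn
    ⟨x₀, mem_closedBall_self hr.le⟩
    (f := fun x => z x - (W x + q x)) (hz.sub (W.continuous.add hq.continuous)).continuousOn
  have hq0 : q x₀ = 0 := by simp [q]
  have hx := hmax (mem_closedBall_self hr.le)
  simp only [mem_ofPred_eq, hq0] at hx
  have hyr : dist y x₀ < r := by
    refine lt_of_le_of_ne hy fun hyr => ?_
    have hqy : q y = 4 * L + 4 := by
      simp only [q, ← dist_eq_norm, hyr, ha]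
      field_simp
    have h1 := abs_le.1 (hWL x₀)
    have h2 := abs_le.1 (hL x₀)
    have h3 := abs_le.1 (hWL y)
    have h4 := abs_le.1 (hL y)
    linarith
  have hyΩ : y ∈ Ω := hrS (closedBall_subset_cthickening hx₀ r hy)
  have hsub := h (fun x => W x + q x) ((W.smooth 2).add hq) y hyΩ
    (hmax.isLocalMax (closedBall_mem_nhds_of_mem hyr))
  rw [lapl_add (W.smooth 2).contDiffAt hq.contDiffAt, lapl_quartic, ← hC] at hsub
  have hWy := hW y
  have hpy := (abs_le.1 (hp y)).1
  have hqy0 : q y = a * ‖y - x₀‖ ^ 4 := by simp only [q]; ring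
  have key : z x₀ - W x₀ ≤ t ^ 2 + t * (g y + C * ‖y - x₀‖ ^ 2) - a * ‖y - x₀‖ ^ 4 := by
    nlinarith
  rcases lt_or_ge ‖y - x₀‖ η with hlt | hge
  · have h1 : g y ≤ g x₀ + ε / 2 := by
      have := hgη (a := y) (b := x₀) (by rw [dist_eq_norm]; exact hlt.trans_le (min_le_left _ _))
      rw [Real.dist_eq] at this
      linarith [(abs_lt.1 this).2]
    have h2 : C * ‖y - x₀‖ ^ 2 ≤ ε / 2 := by
      refine le_trans ?_ hη2
      gcongr
    have h3 : 0 ≤ a * ‖y - x₀‖ ^ 4 := by positivity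
    nlinarith
  · have h1 : a * η ^ 4 ≤ a * ‖y - x₀‖ ^ 4 := by gcongr
    have h2 : C * ‖y - x₀‖ ^ 2 ≤ C * r ^ 2 := by
      gcongr
      rw [← dist_eq_norm]; exact hyr.le
    have h3 := abs_le.1 (hB y)
    have h4 := abs_le.1 (hB x₀)
    nlinarith

lemma LapSub.integral_nonneg_of_hasCompactSupport {Ω : Set (Euc N)} (hΩ : IsOpen Ω)
    {g z : Euc N → ℝ} (hz : Continuous z) (hzc : HasCompactSupport z)
    (hg : Continuous g) (hgc : HasCompactSupport g) (h : LapSub Ω g z)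
    {ψ : Euc N → ℝ} (hψ : ContDiff ℝ ∞ ψ) (hψc : HasCompactSupport ψ) (hψΩ : tsupport ψ ⊆ Ω)
    (hψ0 : ∀ x, 0 ≤ ψ x) :
    0 ≤ (∫ x, lapl ψ x * z x) + ∫ x, ψ x * g x := by
  obtain ⟨L, hL⟩ := hz.bounded_above_of_compact_support hzc
  simp only [Real.norm_eq_abs] at hL
  have hL0 : 0 ≤ L := (abs_nonneg _).trans (hL 0)
  set Ψ : 𝓢(Euc N, ℝ) := hψc.toSchwartzMap hψ
  have hΨ : ∀ x, Ψ x = ψ x := fun x => rfl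
  set Ψ₁ : 𝓢(Euc N, ℝ) := Laplacian.laplacian Ψ
  set Ψ₂ : 𝓢(Euc N, ℝ) := Laplacian.laplacian Ψ₁
  have hΨ₁ : ∀ x, Ψ₁ x = lapl ψ x := fun x => by
    rw [lapl_eq_laplacian]; exact SchwartzMap.laplacian_apply Ψ x
  have hΨ₂ : ∀ x, Ψ₂ x = lapl Ψ₁ x := fun x => by
    rw [lapl_eq_laplacian]; exact SchwartzMap.laplacian_apply Ψ₁ x
  have int : ∀ (φ : 𝓢(Euc N, ℝ)) {q : Euc N → ℝ}, Continuous q → (∃ C, ∀ x, |q x| ≤ C) →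
      Integrable (fun x => φ x * q x) := fun φ q hq hb => by
    obtain ⟨C, hC⟩ := hb
    exact φ.integrable.mul_bdd (c := C) hq.aestronglyMeasurable (Filter.Eventually.of_forall hC)
  have hcl : ∀ W : 𝓢(Euc N, ℝ), Integrable (fun x => Ψ x * lapl W x) ∧
      Integrable (fun x => Ψ₁ x * lapl W x) := fun W => by
    have e : ∀ x, lapl W x = (Laplacian.laplacian W : 𝓢(Euc N, ℝ)) x := fun x => by
      rw [lapl_eq_laplacian]; exact (SchwartzMap.laplacian_apply W x).symm
    simp only [e]
    have hb : ∀ φ : 𝓢(Euc N, ℝ), ∃ C, ∀ x, |φ x| ≤ C := fun φ =>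
      ⟨_, fun x => φ.norm_le_seminorm ℝ x⟩
    exact ⟨int _ (SchwartzMap.continuous _) (hb _), int _ (SchwartzMap.continuous _) (hb _)⟩
  set I₀ := ∫ x, |Ψ x|
  set I₁ := ∫ x, |Ψ₁ x|
  set I₂ := ∫ x, |Ψ₂ x|
  have hI₀ : 0 ≤ I₀ := integral_nonneg fun x => abs_nonneg _
  have hI₁ : 0 ≤ I₁ := integral_nonneg fun x => abs_nonneg _
  have hI₂ : 0 ≤ I₂ := integral_nonneg fun x => abs_nonneg _
  have bd : ∀ (φ : 𝓢(Euc N, ℝ)) {q : Euc N → ℝ} {C : ℝ}, Continuous q → (∀ x, |q x| ≤ C) →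
      ∫ x, φ x * q x ≤ C * ∫ x, |φ x| := fun φ q C hq hC => by
    rw [← integral_const_mul]
    refine integral_mono (int φ hq ⟨C, hC⟩) (φ.integrable.abs.const_mul C) fun x => ?_
    have := hC x
    calc φ x * q x ≤ |φ x * q x| := le_abs_self _
      _ = |q x| * |φ x| := by rw [abs_mul, mul_comm]
      _ ≤ C * |φ x| := by gcongr
  refine le_of_forall_pos_le_add fun δ hδ => ?_
  obtain ⟨t₀, ht₀, hmain⟩ := h.le_resolvent hΩ hz hg hgc hL hψc.isCompact hψΩ
    (ε := δ / (2 * (I₀ + 1))) (by positivity)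
  set ε := δ / (2 * (I₀ + 1)) with hε
  obtain ⟨t, ht, htt⟩ := exists_between (show 0 < min t₀ (min 1 (δ / (2 * (2 * I₀ + I₁ + (L + 1) * I₂ + 1))))
    by positivity)
  have ht1 : t < 1 := htt.trans_le ((min_le_right _ _).trans (min_le_left _ _))
  have ht2 : t * (2 * I₀ + I₁ + (L + 1) * I₂ + 1) ≤ δ / 2 := by
    have := htt.trans_le ((min_le_right _ _).trans (min_le_right _ _))
    rw [lt_div_iff₀ (by positivity)] at this
    linarith
  have hεI : ε * I₀ ≤ δ / 2 := by
    rw [hε, div_mul_eq_mul_div, div_le_div_iff₀ (by positivity) (by norm_num)]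
    nlinarith
  obtain ⟨p, hp, hpz, hps⟩ := hz.exists_contDiff_approx (⊤ : ℕ∞) (ε := fun _ => t ^ 2)
    continuous_const (fun _ => by positivity)
  have hpz' : ∀ x, |p x - z x| ≤ t ^ 2 := fun x => (hpz x).le
  obtain ⟨W, hW⟩ := exists_real_resolvent ht hp (hzc.mono hps)
  have hpL : ∀ x, |p x| ≤ L + 1 := fun x => by
    have h1 := abs_le.1 (hpz' x)
    have h2 := abs_le.1 (hL x)
    rw [abs_le]
    constructor <;> nlinarith
  have hWL := abs_resolvent_le ht hW (by positivity) hpL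
  have hpt := hmain t ht (htt.trans_le (min_le_left _ _)) p W hW hpz'
  obtain ⟨B, hB⟩ := hg.bounded_above_of_compact_support hgc
  have iz : ∀ φ : 𝓢(Euc N, ℝ), Integrable (fun x => φ x * z x) := fun φ => int φ hz ⟨L, hL⟩
  have ig : ∀ φ : 𝓢(Euc N, ℝ), Integrable (fun x => φ x * g x) := fun φ => int φ hg ⟨B, hB⟩
  have ip : ∀ φ : 𝓢(Euc N, ℝ), Integrable (fun x => φ x * p x) :=
    fun φ => int φ hp.continuous ⟨_, hpL⟩
  have iW : ∀ φ : 𝓢(Euc N, ℝ), Integrable (fun x => φ x * W x) :=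
    fun φ => int φ W.continuous ⟨_, hWL⟩
  have e1 : ∫ x, Ψ x * z x ≤ (∫ x, Ψ x * W x) + (t ^ 2 + t * ε) * I₀ + t * ∫ x, Ψ x * g x := by
    have i1 : Integrable fun x => Ψ x * W x + (t ^ 2 + t * ε) * |Ψ x| :=
      (iW _).add (Ψ.integrable.abs.const_mul _)
    rw [← integral_const_mul, ← integral_const_mul, ← integral_add (iW _)
      (Ψ.integrable.abs.const_mul _), ← integral_add i1 ((ig _).const_mul _)]
    refine integral_mono (iz _) (i1.add ((ig _).const_mul _)) fun x => ?_
    simp only [hΨ, abs_of_nonneg (hψ0 x)]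
    by_cases hx : x ∈ tsupport ψ
    · nlinarith [mul_le_mul_of_nonneg_left (hpt x hx) (hψ0 x)]
    · simp [image_eq_zero_of_notMem_tsupport hx]
  have e2 : ∫ x, Ψ x * W x = (∫ x, Ψ x * p x) + t * ∫ x, Ψ₁ x * W x := by
    have := integral_mul_lapl_comm Ψ W
    have e : ∀ x, lapl Ψ x = Ψ₁ x := fun x => (hΨ₁ x).symm
    simp only [e] at this
    rw [← this, ← integral_const_mul, ← integral_add (ip _) ((hcl W).1.const_mul _)]
    refine integral_congr_ae (Filter.Eventually.of_forall fun x => ?_)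
    simp only [← hW x]
    ring
  have e3 : ∫ x, Ψ₁ x * W x = (∫ x, Ψ₁ x * p x) + t * ∫ x, Ψ₂ x * W x := by
    have := integral_mul_lapl_comm Ψ₁ W
    simp only [← hΨ₂] at this
    rw [← this, ← integral_const_mul, ← integral_add (ip _) ((hcl W).2.const_mul _)]
    refine integral_congr_ae (Filter.Eventually.of_forall fun x => ?_)
    simp only [← hW x]
    ring
  have e4 : ∀ φ : 𝓢(Euc N, ℝ), ∫ x, φ x * p x ≤ (∫ x, φ x * z x) + t ^ 2 * ∫ x, |φ x| := by
    intro φ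
    have := bd φ (q := fun x => p x - z x) (hp.continuous.sub hz) hpz'
    simp only [mul_sub] at this
    rw [integral_sub (ip _) (iz _)] at this
    linarith
  have e5 : ∫ x, Ψ₂ x * W x ≤ (L + 1) * I₂ := bd _ W.continuous hWL
  have e6 := e4 Ψ
  have e7 := e4 Ψ₁
  have e8 : ∀ x, lapl ψ x = Ψ₁ x := fun x => (hΨ₁ x).symm
  simp only [e8]
  change 0 ≤ (∫ x, Ψ₁ x * z x) + (∫ x, Ψ x * g x) + δ
  have e9 : 0 ≤ t * ((∫ x, Ψ₁ x * z x) + (∫ x, Ψ x * g x) + ε * I₀ + 2 * t * I₀ + t ^ 2 * I₁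
      + t * ((L + 1) * I₂)) := by
    rw [e3] at e2
    nlinarith [mul_le_mul_of_nonneg_left e5 (sq_nonneg t), mul_le_mul_of_nonneg_left e7 ht.le]
  have e10 := nonneg_of_mul_nonneg_right e9 ht
  nlinarith [mul_nonneg (mul_nonneg ht.le (sub_nonneg.2 ht1.le)) hI₁]

lemma LapSub.integral_nonneg {Ω : Set (Euc N)} (hΩ : IsOpen Ω)
    {g z : Euc N → ℝ} (hz : ContinuousOn z Ω) (hg : ContinuousOn g Ω) (h : LapSub Ω g z)
    {ψ : Euc N → ℝ} (hψ : ContDiff ℝ ∞ ψ) (hψc : HasCompactSupport ψ) (hψΩ : tsupport ψ ⊆ Ω)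
    (hψ0 : ∀ x, 0 ≤ ψ x) :
    0 ≤ (∫ x, lapl ψ x * z x) + ∫ x, ψ x * g x := by
  obtain ⟨U, hUo, hSU, hUΩ, hUc⟩ := exists_open_between_and_isCompact_closure hψc.isCompact hΩ hψΩ
  obtain ⟨χ, hχ1, hχc, hχΩ, -⟩ := exists_continuousMap_one_of_isCompact_subset_isOpen hUc hΩ hUΩ
  have ext : ∀ {q : Euc N → ℝ}, ContinuousOn q Ω → Continuous fun x => χ x * q x := fun hq => by
    refine continuous_iff_continuousAt.2 fun x => ?_
    by_cases hx : x ∈ tsupport χ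
    · exact χ.continuous.continuousAt.mul (hq.continuousAt (hΩ.mem_nhds (hχΩ hx)))
    · refine (continuousAt_const (y := (0 : ℝ))).congr ?_
      filter_upwards [notMem_tsupport_iff_eventuallyEq.1 hx] with y hy
      simp [hy]
  have hcs : ∀ q : Euc N → ℝ, HasCompactSupport fun x => χ x * q x := fun q =>
    HasCompactSupport.mul_right hχc
  have hsub : LapSub U (fun x => χ x * g x) (fun x => χ x * z x) := by
    intro φ hφ x hx hmax
    beta_reduce
    rw [hχ1 (subset_closure hx), Pi.one_apply, one_mul]
    refine h φ hφ x (hUΩ (subset_closure hx)) ?_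
    refine hmax.congr ?_
    filter_upwards [hUo.mem_nhds hx] with y hy
    rw [hχ1 (subset_closure hy), Pi.one_apply, one_mul]
  have main := hsub.integral_nonneg_of_hasCompactSupport hUo (ext hz) (hcs z) (ext hg) (hcs g)
    hψ hψc hSU hψ0
  convert main using 2
  · refine integral_congr_ae (Filter.Eventually.of_forall fun x => ?_)
    by_cases hx : x ∈ tsupport ψ
    · simp [hχ1 (subset_closure (hSU hx))]
    · have : lapl ψ x = 0 := by
        rw [lapl_congr (notMem_tsupport_iff_eventuallyEq.1 hx)]
        exact lapl_const 0 x
      simp [this]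
  · refine integral_congr_ae (Filter.Eventually.of_forall fun x => ?_)
    by_cases hx : x ∈ tsupport ψ
    · simp [hχ1 (subset_closure (hSU hx))]
    · simp [image_eq_zero_of_notMem_tsupport hx]

end Distributional

section Mollification

variable {N : ℕ}

open scoped ContDiff Convolution

lemma two_le_infty : (2 : WithTop ℕ∞) ≤ ∞ := WithTop.coe_le_coe.2 (by exact_mod_cast le_top)

lemma gradient_mul {φ ψ : Euc N → ℝ} {x : Euc N} (h₁ : ContDiffAt ℝ 2 φ x)
    (h₂ : ContDiffAt ℝ 2 ψ x) :
    gradient (fun y => φ y * ψ y) x = φ x • gradient ψ x + ψ x • gradient φ x := by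
  simp only [gradient]
  rw [fderiv_fun_mul (h₁.differentiableAt (by norm_num)) (h₂.differentiableAt (by norm_num)),
    map_add, map_smul, map_smul]

lemma lapl_sq {φ : Euc N → ℝ} {x : Euc N} (h : ContDiffAt ℝ 2 φ x) :
    lapl (fun y => φ y ^ 2) x = 2 * ‖gradient φ x‖ ^ 2 + 2 * φ x * lapl φ x := by
  refine lapl_comp (F := fun s => s ^ 2) (F' := fun s => 2 * s) (c := 2) h ?_ ?_
  · exact Filter.Eventually.of_forall fun s => by simpa using hasDerivAt_pow 2 s
  · simpa using (hasDerivAt_id (φ x)).const_mul 2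

lemma lapl_mul {φ ψ : Euc N → ℝ} {x : Euc N} (h₁ : ContDiffAt ℝ 2 φ x)
    (h₂ : ContDiffAt ℝ 2 ψ x) :
    lapl (fun y => φ y * ψ y) x =
      φ x * lapl ψ x + 2 * inner ℝ (gradient φ x) (gradient ψ x) + ψ x * lapl φ x := by
  have e : (fun y => φ y * ψ y) =
      fun y => (1 / 4) * ((φ y + ψ y) ^ 2 - (φ y - ψ y) ^ 2) := by
    funext y; ring
  rw [e, lapl_const_mul _ (((h₁.add h₂).pow 2).sub ((h₁.sub h₂).pow 2)),
    lapl_sub ((h₁.add h₂).pow 2) ((h₁.sub h₂).pow 2), lapl_sq (h₁.add h₂), lapl_sq (h₁.sub h₂),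
    lapl_add h₁ h₂, lapl_sub h₁ h₂, gradient_add h₁ h₂, gradient_sub h₁ h₂,
    norm_add_sq_real, norm_sub_sq_real]
  ring

lemma contDiff_expInner {n : WithTop ℕ∞} (β : Euc N) :
    ContDiff ℝ n fun x : Euc N => Real.exp (inner ℝ β x) :=
  Real.contDiff_exp.comp (innerSL ℝ β).contDiff

lemma gradient_inner (β x : Euc N) : gradient (fun x : Euc N => inner ℝ β x) x = β := by
  refine ext_inner_right ℝ fun v => ?_
  rw [inner_gradient]
  exact congrArg (fun T : Euc N →L[ℝ] ℝ => T v) (innerSL ℝ β).fderiv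

lemma lapl_inner (β x : Euc N) : lapl (fun x : Euc N => inner ℝ β x) x = 0 := by
  rw [lapl_eq_sum_fderiv]
  have : fderiv ℝ (fun x : Euc N => inner ℝ β x) = fun _ => innerSL ℝ β :=
    funext fun x => (innerSL ℝ β).fderiv
  simp [this]

lemma gradient_expInner (β x : Euc N) :
    gradient (fun x : Euc N => Real.exp (inner ℝ β x)) x = Real.exp (inner ℝ β x) • β := by
  rw [gradient_comp (F := Real.exp) (s := fun x : Euc N => inner ℝ β x)
    (innerSL ℝ β).contDiff.contDiffAt (Real.hasDerivAt_exp _), gradient_inner]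

lemma lapl_expInner (β x : Euc N) :
    lapl (fun x : Euc N => Real.exp (inner ℝ β x)) x = Real.exp (inner ℝ β x) * ‖β‖ ^ 2 := by
  rw [lapl_comp (F := Real.exp) (F' := Real.exp) (s := fun x : Euc N => inner ℝ β x)
    (innerSL ℝ β).contDiff.contDiffAt (Filter.Eventually.of_forall Real.hasDerivAt_exp) (Real.hasDerivAt_exp _),
    gradient_inner, lapl_inner]
  ring

/-- Tangent hyperplane inequality for the convex function `|q|^m`. -/
lemma norm_rpow_tangent_le {m : ℝ} (hm : 2 < m) (p q : Euc N) :
    inner ℝ ((m * ‖p‖ ^ (m - 2)) • p) q - (m - 1) * ‖p‖ ^ m ≤ ‖q‖ ^ m := by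
  rcases eq_or_ne p 0 with rfl | hp
  · simp [Real.zero_rpow (show m ≠ 0 by linarith)]
    positivity
  have hp0 : 0 < ‖p‖ := norm_pos_iff.2 hp
  have h1 := one_add_mul_self_le_rpow_one_add (s := ‖q‖ / ‖p‖ - 1)
    (by linarith [div_nonneg (norm_nonneg q) hp0.le]) (p := m) (by linarith)
  rw [add_sub_cancel, Real.div_rpow (norm_nonneg _) hp0.le, le_div_iff₀ (by positivity)] at h1
  have h2 : ‖p‖ ^ m = ‖p‖ ^ (m - 2) * ‖p‖ ^ 2 := by
    rw [← Real.rpow_natCast ‖p‖ 2, ← Real.rpow_add hp0]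
    norm_num
  have h3 : ‖q‖ / ‖p‖ * ‖p‖ ^ m = ‖p‖ ^ (m - 2) * (‖p‖ * ‖q‖) := by
    rw [h2]; field_simp
  have h4 : inner ℝ ((m * ‖p‖ ^ (m - 2)) • p) q ≤ m * (‖p‖ ^ (m - 2) * (‖p‖ * ‖q‖)) := by
    rw [inner_smul_left]
    simp only [map_mul, conj_trivial, mul_assoc]
    have := real_inner_le_norm p q
    gcongr
  nlinarith

lemma inner_tangent_self {m : ℝ} (hm : 2 < m) (p : Euc N) :
    inner ℝ ((m * ‖p‖ ^ (m - 2)) • p) p = m * ‖p‖ ^ m := by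
  rcases eq_or_ne p 0 with rfl | hp
  · simp [Real.zero_rpow (show m ≠ 0 by linarith)]
  have hp0 : 0 < ‖p‖ := norm_pos_iff.2 hp
  have h2 : ‖p‖ ^ m = ‖p‖ ^ (m - 2) * ‖p‖ ^ 2 := by
    rw [← Real.rpow_natCast ‖p‖ 2, ← Real.rpow_add hp0]
    norm_num
  rw [inner_smul_left, real_inner_self_eq_norm_sq, h2]
  simp
  ring

/-- Viscosity subsolution of `−Δw + |Dw|^m + λw ≤ f` in `Ω`, without boundary condition. -/
def IsViscSub (Ω : Set (Euc N)) (f : Euc N → ℝ) (lam m : ℝ) (w : Euc N → ℝ) : Prop :=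
  ∀ φ : Euc N → ℝ, ContDiff ℝ 2 φ → ∀ x ∈ Ω, IsLocalMax (fun y => w y - φ y) x →
    statOp f lam m φ (w x) x ≤ 0

lemma IsViscSub.lapSub {Ω : Set (Euc N)} {f : Euc N → ℝ} {lam m : ℝ} (hm : 2 < m)
    {w : Euc N → ℝ} (hw : IsViscSub Ω f lam m w) (p : Euc N) {β : Euc N}
    (hβ : (2 : ℝ) • β = (m * ‖p‖ ^ (m - 2)) • p) :
    LapSub Ω (fun x => Real.exp (-inner ℝ β x) * (f x - lam * w x + (m - 1) * ‖p‖ ^ m) -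
      ‖β‖ ^ 2 * (Real.exp (-inner ℝ β x) * w x)) (fun x => Real.exp (-inner ℝ β x) * w x) := by
  intro φ hφ x hx hmax
  set c := Real.exp (-inner ℝ β x) * w x - φ x with hc
  set E : Euc N → ℝ := fun y => Real.exp (inner ℝ β y) with hE
  have hE' : ∀ y, Real.exp (-inner ℝ β y) * E y = 1 := fun y => by
    rw [hE, ← Real.exp_add]; simp
  have hEp : ∀ y, 0 < E y := fun y => Real.exp_pos _
  have hEd : ContDiff ℝ 2 E := contDiff_expInner β
  have hφc : ContDiff ℝ 2 fun y => φ y + c := hφ.add contDiff_const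
  have h1 : IsLocalMax (fun y => w y - E y * (φ y + c)) x := by
    filter_upwards [hmax] with y hy
    have e1 : w x - E x * (φ x + c) = 0 := by
      rw [hc]; linear_combination (-w x) * hE' x
    have e2 : w y = E y * (Real.exp (-inner ℝ β y) * w y) := by
      linear_combination (-w y) * hE' y
    rw [e1, e2, ← mul_sub]
    exact mul_nonpos_of_nonneg_of_nonpos (hEp y).le (by linarith)
  have h2 := hw _ (hEd.mul hφc) x hx h1
  have h3 := norm_rpow_tangent_le hm p (gradient (fun y => E y * (φ y + c)) x)
  rw [statOp] at h2
  rw [← hβ] at h3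
  have e3 : lapl (fun y => φ y + c) x = lapl φ x := by
    rw [lapl_add hφ.contDiffAt contDiffAt_const, lapl_const, add_zero]
  have e4 : gradient (fun y => φ y + c) x = gradient φ x := by
    rw [gradient_add hφ.contDiffAt contDiffAt_const]
    simp [gradient]
  rw [lapl_mul hEd.contDiffAt hφc.contDiffAt, lapl_expInner, gradient_expInner, e3, e4] at h2
  rw [gradient_mul hEd.contDiffAt hφc.contDiffAt, gradient_expInner, e4] at h3
  simp only [inner_smul_left, inner_add_right, inner_smul_right, conj_trivial,
    real_inner_self_eq_norm_sq] at h3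
  simp only [inner_smul_left, conj_trivial] at h2
  have e5 : φ x + c = Real.exp (-inner ℝ β x) * w x := by rw [hc]; ring
  rw [gradient_mul hEd.contDiffAt hφc.contDiffAt, gradient_expInner, e4] at h2
  rw [e5] at h2 h3
  have e6 := hE' x
  have e7 : Real.exp (inner ℝ β x) = E x := rfl
  simp only [e7] at h2 h3
  set e := Real.exp (-inner ℝ β x)
  have he : 0 < e := Real.exp_pos _
  have key : E x * (-lapl φ x) + E x * (‖β‖ ^ 2 * (e * w x)) ≤
      f x - lam * w x + (m - 1) * ‖p‖ ^ m := by
    linarith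
  have := mul_le_mul_of_nonneg_left key he.le
  have e8 : e * (E x * (-lapl φ x) + E x * (‖β‖ ^ 2 * (e * w x))) =
      -lapl φ x + ‖β‖ ^ 2 * (e * w x) := by
    linear_combination (-lapl φ x + ‖β‖ ^ 2 * (e * w x)) * e6
  linarith

/-- Mollification of `w` by the kernel `κ`. -/
noncomputable def moll (w κ : Euc N → ℝ) (x : Euc N) : ℝ := ∫ y, w y * κ (x - y)

lemma moll_eq_convolution (w κ : Euc N → ℝ) :
    moll w κ = w ⋆[ContinuousLinearMap.mul ℝ ℝ, volume] κ := rfl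

lemma contDiff_moll {w κ : Euc N → ℝ} (hw : LocallyIntegrable w) (hκ : ContDiff ℝ ∞ κ)
    (hκc : HasCompactSupport κ) : ContDiff ℝ ∞ (moll w κ) :=
  hκc.contDiff_convolution_right (ContinuousLinearMap.mul ℝ ℝ) hw hκ

lemma fderiv_moll {w κ : Euc N → ℝ} (hw : LocallyIntegrable w) (hκ : ContDiff ℝ ∞ κ)
    (hκc : HasCompactSupport κ) (x v : Euc N) :
    fderiv ℝ (moll w κ) x v = moll w (fun t => fderiv ℝ κ t v) x := by
  have h := hκc.hasFDerivAt_convolution_right (ContinuousLinearMap.mul ℝ ℝ) hw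
    (hκ.of_le (by exact_mod_cast le_top)) x
  rw [moll_eq_convolution, h.fderiv, moll_eq_convolution]
  exact convolution_precompR_apply _ hw (hκc.fderiv ℝ) (hκ.continuous_fderiv (by simp)) x v

lemma contDiff_fderiv_apply {κ : Euc N → ℝ} (hκ : ContDiff ℝ ∞ κ) (v : Euc N) :
    ContDiff ℝ ∞ fun t => fderiv ℝ κ t v :=
  (hκ.fderiv_right (m := ∞) (by simp)).clm_apply contDiff_const

lemma inner_gradient_moll {w κ : Euc N → ℝ} (hw : LocallyIntegrable w) (hκ : ContDiff ℝ ∞ κ)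
    (hκc : HasCompactSupport κ) (x v : Euc N) :
    inner ℝ v (gradient (moll w κ) x) = ∫ y, w y * inner ℝ v (gradient κ (x - y)) := by
  rw [real_inner_comm, inner_gradient, fderiv_moll hw hκ hκc]
  have e : ∀ t, inner ℝ v (gradient κ t) = fderiv ℝ κ t v := fun t => by
    rw [real_inner_comm, inner_gradient]
  simp only [e, moll]

lemma integrable_mul_comp_sub {w κ : Euc N → ℝ} (hw : LocallyIntegrable w) (hκ : Continuous κ)
    (hκc : HasCompactSupport κ) (x : Euc N) : Integrable fun y => w y * κ (x - y) :=
  hw.integrable_smul_right_of_hasCompactSupport (hκ.comp (continuous_const.sub continuous_id))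
    (hκc.comp_homeomorph (Homeomorph.subLeft x))

lemma lapl_apply_eq {κ : Euc N → ℝ} (hκ : ContDiff ℝ ∞ κ) (x : Euc N) :
    lapl κ x = ∑ i : Fin N, fderiv ℝ (fun t => fderiv ℝ κ t (EuclideanSpace.single i 1)) x
      (EuclideanSpace.single i 1) := by
  rw [lapl_eq_sum_fderiv]
  refine Finset.sum_congr rfl fun i _ => ?_
  have hd : DifferentiableAt ℝ (fderiv ℝ κ) x :=
    ((hκ.fderiv_right (m := ∞) (by simp)).differentiable (by simp)) x
  rw [fderiv_clm_apply hd (differentiableAt_const _)]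
  simp

lemma lapl_moll {w κ : Euc N → ℝ} (hw : LocallyIntegrable w) (hκ : ContDiff ℝ ∞ κ)
    (hκc : HasCompactSupport κ) (x : Euc N) :
    lapl (moll w κ) x = ∫ y, w y * lapl κ (x - y) := by
  have h1 := fun v => contDiff_fderiv_apply hκ v
  have h2 : ∀ v, HasCompactSupport fun t => fderiv ℝ κ t v := fun v => hκc.fderiv_apply ℝ v
  rw [lapl_apply_eq (contDiff_moll hw hκ hκc)]
  simp only [fderiv_moll hw hκ hκc, lapl_apply_eq hκ, Finset.mul_sum]
  rw [integral_finsetSum]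
  · refine Finset.sum_congr rfl fun i _ => ?_
    exact fderiv_moll hw (h1 _) (h2 _) x _
  · exact fun i _ => integrable_mul_comp_sub hw (contDiff_fderiv_apply (h1 _) _).continuous
      ((h2 _).fderiv_apply ℝ _) x

lemma fderiv_comp_const_sub {G : Type*} [NormedAddCommGroup G] [NormedSpace ℝ G] {F : Euc N → G}
    (hF : Differentiable ℝ F) (x y : Euc N) :
    fderiv ℝ (fun y => F (x - y)) y = -fderiv ℝ F (x - y) := by
  have h := (hF (x - y)).hasFDerivAt.comp y ((hasFDerivAt_id y).const_sub x)
  rw [show (fun y => F (x - y)) = F ∘ fun y => x - y from rfl, h.fderiv]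
  ext v
  simp

lemma gradient_comp_const_sub {κ : Euc N → ℝ} (hκ : Differentiable ℝ κ) (x y : Euc N) :
    gradient (fun y => κ (x - y)) y = -gradient κ (x - y) := by
  simp only [gradient]
  rw [fderiv_comp_const_sub hκ, map_neg]

lemma lapl_comp_const_sub {κ : Euc N → ℝ} (hκ : ContDiff ℝ 2 κ) (x y : Euc N) :
    lapl (fun y => κ (x - y)) y = lapl κ (x - y) := by
  simp only [lapl_eq_sum_fderiv]
  have h1 : fderiv ℝ (fun y => κ (x - y)) = fun y => -fderiv ℝ κ (x - y) :=
    funext fun y => fderiv_comp_const_sub (hκ.differentiable (by norm_num)) x y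
  rw [h1, fderiv_fun_neg,
    fderiv_comp_const_sub ((hκ.fderiv_right (m := 1) (by norm_num)).differentiable (by norm_num))]
  simp

/-- Mollifications of viscosity subsolutions are classical subsolutions. -/
theorem IsViscSub.eikOp_moll_le {Ω : Set (Euc N)} (hΩ : IsOpen Ω) {f : Euc N → ℝ} {lam m : ℝ}
    (hm : 2 < m) {w κ : Euc N → ℝ} (hw : IsViscSub Ω f lam m w) (hwc : ContinuousOn w Ω)
    (hwi : LocallyIntegrable w) (hfc : ContinuousOn f Ω) (hfi : LocallyIntegrable f)
    (hκ : ContDiff ℝ ∞ κ) (hκc : HasCompactSupport κ) (hκ0 : ∀ t, 0 ≤ κ t) (hκ1 : ∫ t, κ t = 1)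
    {x : Euc N} (hx : ∀ t ∈ tsupport κ, x - t ∈ Ω) :
    eikOp m (moll w κ) x + lam * moll w κ x ≤ moll f κ x := by
  set p := gradient (moll w κ) x with hp
  set β : Euc N := (1 / 2 : ℝ) • ((m * ‖p‖ ^ (m - 2)) • p) with hβ
  have hβ2 : (2 : ℝ) • β = (m * ‖p‖ ^ (m - 2)) • p := by
    rw [hβ, smul_smul]; norm_num
  have hκ2 : ContDiff ℝ 2 κ := hκ.of_le two_le_infty
  have hk : ContDiff ℝ ∞ fun y => κ (x - y) := hκ.comp (contDiff_const.sub contDiff_id)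
  have hkc : HasCompactSupport fun y => κ (x - y) := hκc.comp_homeomorph (Homeomorph.subLeft x)
  have hkt : tsupport (fun y => κ (x - y)) ⊆ Ω := by
    intro y hy
    have := hx (x - y) (tsupport_comp_subset_preimage κ
      (continuous_const.sub continuous_id : Continuous fun y : Euc N => x - y) hy)
    simpa using this
  have hec : Continuous fun y : Euc N => Real.exp (-inner ℝ β y) := by fun_prop
  have h := (hw.lapSub hm p hβ2).integral_nonneg
    (ψ := fun y => Real.exp (inner ℝ β y) * κ (x - y)) hΩ (hec.continuousOn.mul hwc)
    ((hec.continuousOn.mul ((hfc.sub (hwc.const_mul lam)).add continuousOn_const)).sub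
      ((hec.continuousOn.mul hwc).const_mul _))
    ((contDiff_expInner β).mul hk) (hkc.mul_left (f' := fun y => κ (x - y)))
    ((tsupport_mul_subset_right (f := fun y => Real.exp (inner ℝ β y))).trans hkt)
    (fun y => mul_nonneg (Real.exp_pos _).le (hκ0 _))
  have hE : ∀ y : Euc N, Real.exp (inner ℝ β y) * Real.exp (-inner ℝ β y) = 1 := fun y => by
    rw [← Real.exp_add]; simp
  have e1 : ∀ y, lapl (fun y => Real.exp (inner ℝ β y) * κ (x - y)) y *
      (Real.exp (-inner ℝ β y) * w y) = w y * lapl κ (x - y) -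
        w y * inner ℝ ((2 : ℝ) • β) (gradient κ (x - y)) + ‖β‖ ^ 2 * (w y * κ (x - y)) := by
    intro y
    rw [lapl_mul (contDiff_expInner β).contDiffAt (hk.of_le two_le_infty).contDiffAt,
      lapl_comp_const_sub hκ2, gradient_comp_const_sub (hκ2.differentiable (by norm_num)), lapl_expInner, gradient_expInner]
    simp only [inner_smul_left, inner_neg_right, conj_trivial]
    linear_combination (w y * lapl κ (x - y) - 2 * w y * inner ℝ β (gradient κ (x - y)) +
      ‖β‖ ^ 2 * (w y * κ (x - y))) * hE y
  have e2 : ∀ y, Real.exp (inner ℝ β y) * κ (x - y) *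
      (Real.exp (-inner ℝ β y) * (f y - lam * w y + (m - 1) * ‖p‖ ^ m) -
        ‖β‖ ^ 2 * (Real.exp (-inner ℝ β y) * w y)) = f y * κ (x - y) - lam * (w y * κ (x - y)) +
          (m - 1) * ‖p‖ ^ m * κ (x - y) - ‖β‖ ^ 2 * (w y * κ (x - y)) := by
    intro y
    linear_combination (f y * κ (x - y) - lam * (w y * κ (x - y)) +
          (m - 1) * ‖p‖ ^ m * κ (x - y) - ‖β‖ ^ 2 * (w y * κ (x - y))) * hE y
  have i1 : Integrable fun y => w y * κ (x - y) := integrable_mul_comp_sub hwi hκ.continuous hκc x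
  have i2 : Integrable fun y => f y * κ (x - y) := integrable_mul_comp_sub hfi hκ.continuous hκc x
  have i3 : Integrable fun y => κ (x - y) := hk.continuous.integrable_of_hasCompactSupport hkc
  have i4 : Integrable fun y => w y * lapl κ (x - y) := by
    refine integrable_mul_comp_sub hwi (continuous_iff_continuousAt.2 fun t =>
      continuousAt_lapl hκ2.contDiffAt) ?_ x
    refine hκc.mono' fun t ht => ?_
    by_contra hn
    refine ht ?_
    have : κ =ᶠ[𝓝 t] fun _ => 0 := notMem_tsupport_iff_eventuallyEq.1 hn
    rw [lapl_congr this, lapl_const]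
  have i5 : Integrable fun y => w y * inner ℝ ((2 : ℝ) • β) (gradient κ (x - y)) := by
    have e : ∀ t, inner ℝ ((2 : ℝ) • β) (gradient κ t) = fderiv ℝ κ t ((2 : ℝ) • β) := fun t => by
      rw [real_inner_comm, inner_gradient]
    simp only [e]
    exact integrable_mul_comp_sub hwi (contDiff_fderiv_apply hκ _).continuous
      (hκc.fderiv_apply ℝ _) x
  simp only [Pi.mul_apply, Pi.sub_apply, Pi.add_apply, e1, e2] at h
  have j1 := i4.sub i5
  have j2 := i1.const_mul (‖β‖ ^ 2)
  have j3 := i2.sub (i1.const_mul lam)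
  have j4 := j3.add (i3.const_mul ((m - 1) * ‖p‖ ^ m))
  have s1 := integral_add j1 j2
  have s2 := integral_sub i4 i5
  have s3 := integral_sub j4 j2
  have s4 := integral_add j3 (i3.const_mul ((m - 1) * ‖p‖ ^ m))
  have s5 := integral_sub i2 (i1.const_mul lam)
  simp only [Pi.sub_apply, Pi.add_apply] at s1 s2 s3 s4 s5
  rw [s1, s2, s3, s4, s5,
    integral_const_mul, integral_const_mul, integral_const_mul, ← lapl_moll hwi hκ hκc,
    ← inner_gradient_moll hwi hκ hκc, ← hp, hβ2, inner_tangent_self hm,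
    integral_sub_left_eq_self κ volume x, hκ1] at h
  have e3 : ∫ y, w y * κ (x - y) = moll w κ x := rfl
  have e4 : ∫ y, f y * κ (x - y) = moll f κ x := rfl
  rw [e3, e4] at h
  rw [eikOp, ← hp]
  linarith

end Mollification

section Geometry

variable {N : ℕ}

/-- `s` is a `C²` defining function of `Ω`, positive inside `Ω`. -/
structure IsDefFun (Ω : Set (Euc N)) (s : Euc N → ℝ) : Prop where
  contDiff : ContDiff ℝ 2 s
  mem_iff : ∀ x, x ∈ Ω ↔ 0 < s x
  mem_frontier_iff : ∀ x, x ∈ frontier Ω ↔ s x = 0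
  gradient_ne : ∀ x ∈ frontier Ω, gradient s x ≠ 0

lemma HasC2Boundary.exists_isDefFun {Ω : Set (Euc N)} (h : HasC2Boundary Ω) :
    ∃ s, IsDefFun Ω s := by
  obtain ⟨ρ, hρ, hΩ, hfr, hg⟩ := h
  refine ⟨fun x => -ρ x, hρ.neg, fun x => ?_, fun x => ?_, fun x hx h0 => hg x hx ?_⟩
  · rw [hΩ]; simp
  · rw [hfr]; simp
  · have e := gradient_const_mul (-1) (hρ.contDiffAt (x := x))
    simp only [neg_mul, one_mul] at e
    rw [h0] at e
    simpa using e.symm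

namespace IsDefFun

variable {Ω : Set (Euc N)} {s : Euc N → ℝ}

lemma mem_closure_iff (h : IsDefFun Ω s) (x : Euc N) : x ∈ closure Ω ↔ 0 ≤ s x := by
  rw [closure_eq_self_union_frontier, mem_union, h.mem_iff, h.mem_frontier_iff, le_iff_lt_or_eq,
    eq_comm (a := (0 : ℝ))]

/-- First order expansion of `s`, uniform near a point. -/
lemma eventually_expansion (h : IsDefFun Ω s) (z : Euc N) {ε : ℝ} (hε : 0 < ε) :
    ∃ r > 0, ∀ x ∈ ball z r, ∀ y ∈ ball z r,
      |s y - s x - inner ℝ (gradient s z) (y - x)| ≤ ε * ‖y - x‖ := by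
  have h1 : HasStrictFDerivAt s (fderiv ℝ s z) z :=
    h.contDiff.contDiffAt.hasStrictFDerivAt (by norm_num)
  have h2 := (h1.isLittleO.bound hε)
  rw [nhds_prod_eq] at h2
  obtain ⟨p, hp, q, hq, hpq⟩ := Filter.eventually_prod_iff.1 h2
  obtain ⟨r, hr, hrb⟩ := Metric.eventually_nhds_iff_ball.1 (hp.and hq)
  refine ⟨r, hr, fun x hx y hy => ?_⟩
  have := hpq (hrb y hy).1 (hrb x hx).2
  rwa [inner_gradient, ← Real.norm_eq_abs]

lemma exists_cone_of_mem_frontier (h : IsDefFun Ω s) {z : Euc N} (hz : z ∈ frontier Ω) :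
    ∃ n : Euc N, ‖n‖ ≤ 1 ∧ ∃ r > 0, r ≤ 1 ∧ ∀ x ∈ closure Ω, ‖x - z‖ ≤ r →
      ∀ t, 0 < t → t ≤ r → ball (x + t • n) (t / 4) ⊆ Ω := by
  set g := gradient s z with hg
  have hg0 : 0 < ‖g‖ := norm_pos_iff.2 (h.gradient_ne z hz)
  obtain ⟨r, hr, hexp⟩ := h.eventually_expansion z (ε := ‖g‖ / 8) (by positivity)
  refine ⟨‖g‖⁻¹ • g, ?_, min 1 (r / 4), by positivity, min_le_left _ _, ?_⟩
  · rw [norm_smul, norm_inv, norm_norm, inv_mul_cancel₀ hg0.ne']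
  intro x hx hxz t ht htr y hy
  set n := ‖g‖⁻¹ • g with hn
  have hn1 : ‖n‖ = 1 := by
    rw [hn, norm_smul, norm_inv, norm_norm, inv_mul_cancel₀ hg0.ne']
  have htr' : t ≤ r / 4 := htr.trans (min_le_right _ _)
  have hxr : ‖x - z‖ ≤ r / 4 := hxz.trans (min_le_right _ _)
  rw [mem_ball, dist_eq_norm] at hy
  set e := y - (x + t • n) with he
  have hyx : y - x = t • n + e := by rw [he]; abel
  have hnorm : ‖y - x‖ ≤ 2 * t := by
    rw [hyx]
    refine (norm_add_le _ _).trans ?_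
    rw [norm_smul, hn1, Real.norm_of_nonneg ht.le]
    linarith
  have hyz : ‖y - z‖ < r := by
    have : y - z = (y - x) + (x - z) := by abel
    rw [this]
    refine (norm_add_le _ _).trans_lt ?_
    linarith
  have h1 := hexp x (by rw [mem_ball, dist_eq_norm]; linarith) y
    (by rwa [mem_ball, dist_eq_norm])
  have h2 : inner ℝ g (y - x) ≥ t * ‖g‖ - ‖g‖ * (t / 4) := by
    rw [hyx, inner_add_right, inner_smul_right]
    have e1 : inner ℝ g n = ‖g‖ := by
      rw [hn, inner_smul_right, real_inner_self_eq_norm_sq]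
      field_simp
    have e2 := abs_le.1 (abs_real_inner_le_norm g e)
    have e3 : ‖g‖ * ‖e‖ ≤ ‖g‖ * (t / 4) := by gcongr
    rw [e1]
    linarith [e2.1]
  have h3 := (abs_le.1 h1).1
  have h4 := (h.mem_closure_iff x).1 hx
  rw [h.mem_iff]
  have h5 : ‖g‖ / 8 * ‖y - x‖ ≤ ‖g‖ / 8 * (2 * t) := by gcongr
  nlinarith [mul_pos hg0 ht]

/-- Interior cone condition, uniform near every point of the closure. -/
lemma exists_cone (h : IsDefFun Ω s) (hΩ : IsOpen Ω) {z : Euc N} (hz : z ∈ closure Ω) :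
    ∃ n : Euc N, ‖n‖ ≤ 1 ∧ ∃ r > 0, r ≤ 1 ∧ ∀ x ∈ closure Ω, ‖x - z‖ ≤ r →
      ∀ t, 0 < t → t ≤ r → ball (x + t • n) (t / 4) ⊆ Ω := by
  rw [closure_eq_self_union_frontier] at hz
  rcases hz with hz | hz
  · obtain ⟨r, hr, hrb⟩ := Metric.isOpen_iff.1 hΩ z hz
    refine ⟨0, by simp, min 1 (r / 2), by positivity, min_le_left _ _, ?_⟩
    intro x _ hxz t ht htr y hy
    refine hrb ?_
    have h1 := hxz.trans (min_le_right _ _)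
    have h2 := htr.trans (min_le_right _ _)
    rw [smul_zero, add_zero, mem_ball] at hy
    rw [mem_ball]
    rw [← dist_eq_norm] at h1
    linarith [dist_triangle y x z]
  · exact h.exists_cone_of_mem_frontier hz

/-- The defining function controls the distance to the boundary. -/
lemma exists_mul_infDist_le (h : IsDefFun Ω s) (hb : Bornology.IsBounded Ω) :
    ∃ c > 0, ∀ x ∈ Ω, c * infDist x (frontier Ω) ≤ s x := by
  have hK : IsCompact (closure Ω) := hb.isCompact_closure
  suffices H : ∃ c > 0, ∀ x ∈ closure Ω, c * infDist x (frontier Ω) ≤ s x by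
    obtain ⟨c, hc, H⟩ := H
    exact ⟨c, hc, fun x hx => H x (subset_closure hx)⟩
  refine hK.induction_on (p := fun S => ∃ c > 0, ∀ x ∈ S, c * infDist x (frontier Ω) ≤ s x)
    ⟨1, one_pos, by simp⟩ ?_ ?_ ?_
  · rintro S T hST ⟨c, hc, H⟩
    exact ⟨c, hc, fun x hx => H x (hST hx)⟩
  · rintro S T ⟨c, hc, H⟩ ⟨d, hd, H'⟩
    refine ⟨min c d, by positivity, ?_⟩
    rintro x (hx | hx)
    · exact (mul_le_mul_of_nonneg_right (min_le_left _ _) infDist_nonneg).trans (H x hx)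
    · exact (mul_le_mul_of_nonneg_right (min_le_right _ _) infDist_nonneg).trans (H' x hx)
  intro z hz
  rw [closure_eq_self_union_frontier] at hz
  rcases hz with hz | hz
  · have hsz := (h.mem_iff z).1 hz
    have hU : ∀ᶠ x in 𝓝 z, s z / 2 < s x ∧ infDist x (frontier Ω) < infDist z (frontier Ω) + 1 :=
      (h.contDiff.continuous.continuousAt.eventually_const_lt (by linarith)).and
        ((continuous_infDist_pt _).continuousAt.eventually_lt_const (by linarith))
    have hp : 0 < infDist z (frontier Ω) + 1 := by linarith [infDist_nonneg (x := z) (s := frontier Ω)]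
    refine ⟨_, mem_nhdsWithin_of_mem_nhds hU, s z / 2 / (infDist z (frontier Ω) + 1),
      by positivity, fun x hx => ?_⟩
    refine le_trans ?_ hx.1.le
    rw [div_mul_eq_mul_div, div_le_iff₀ hp]
    exact mul_le_mul_of_nonneg_left hx.2.le (by linarith)
  · set g := gradient s z with hg
    have hg0 : 0 < ‖g‖ := norm_pos_iff.2 (h.gradient_ne z hz)
    obtain ⟨r, hr, hexp⟩ := h.eventually_expansion z (ε := ‖g‖ / 2) (by positivity)
    have hs0 : s z = 0 := (h.mem_frontier_iff z).1 hz
    have hU : ∀ᶠ x in 𝓝 z, s x < ‖g‖ * r / 4 :=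
      h.contDiff.continuous.continuousAt.eventually_lt_const (by rw [hs0]; positivity)
    refine ⟨closure Ω ∩ ({x | s x < ‖g‖ * r / 4} ∩ ball z (r / 2)), Filter.inter_mem
      self_mem_nhdsWithin (mem_nhdsWithin_of_mem_nhds (Filter.inter_mem hU
        (ball_mem_nhds z (by positivity)))), ‖g‖ / 2, by positivity, fun x hx => ?_⟩
    obtain ⟨hxc, hxs, hxb⟩ := hx
    have hxs' : s x < ‖g‖ * r / 4 := hxs
    have hsx := (h.mem_closure_iff x).1 hxc
    set T := 2 * s x / ‖g‖ ^ 2 with hT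
    have hT0 : 0 ≤ T := by positivity
    have hTg : T * ‖g‖ = 2 * s x / ‖g‖ := by rw [hT]; field_simp
    have hTr : T * ‖g‖ < r / 2 := by
      rw [hTg, div_lt_iff₀ hg0]; linarith
    have hin : ‖x - z‖ < r / 2 := by rwa [mem_ball, dist_eq_norm] at hxb
    have key := hexp x (by rw [mem_ball, dist_eq_norm]; linarith) (x - T • g) (by
      rw [mem_ball, dist_eq_norm, sub_right_comm]
      refine (norm_sub_le _ _).trans_lt ?_
      rw [norm_smul, Real.norm_of_nonneg hT0]
      linarith)
    have hle : s (x - T • g) ≤ 0 := by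
      have e1 : x - T • g - x = -(T • g) := by abel
      rw [e1, inner_neg_right, inner_smul_right, real_inner_self_eq_norm_sq, norm_neg, norm_smul,
        Real.norm_of_nonneg hT0] at key
      have e2 := (abs_le.1 key).2
      have e3 : T * ‖g‖ ^ 2 = 2 * s x := by rw [hT]; field_simp
      nlinarith
    have hcont : ContinuousOn (fun t : ℝ => s (x - t • g)) (Icc 0 T) :=
      (h.contDiff.continuous.comp (by fun_prop)).continuousOn
    obtain ⟨t, ht, hts⟩ := intermediate_value_Icc' hT0 hcont
      (show (0 : ℝ) ∈ Icc _ _ from ⟨hle, by simpa using hsx⟩)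
    have hd := infDist_le_dist_of_mem (x := x) ((h.mem_frontier_iff (x - t • g)).2 hts)
    rw [dist_eq_norm, sub_sub_cancel, norm_smul, Real.norm_of_nonneg ht.1] at hd
    have : infDist x (frontier Ω) ≤ 2 * s x / ‖g‖ := by
      rw [← hTg]; exact hd.trans (mul_le_mul_of_nonneg_right ht.2 hg0.le)
    rw [le_div_iff₀ hg0] at this
    linarith

lemma exists_le_or_le (h : IsDefFun Ω s) (hb : Bornology.IsBounded Ω) :
    ∃ c > 0, ∀ x ∈ closure Ω, c ≤ s x ∨ c ≤ ‖gradient s x‖ := by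
  have hK : IsCompact (closure Ω) := hb.isCompact_closure
  have hc : Continuous fun x => s x + ‖gradient s x‖ :=
    h.contDiff.continuous.add
      (continuous_iff_continuousAt.2 fun x => continuousAt_gradient h.contDiff.contDiffAt).norm
  have hpos : ∀ x ∈ closure Ω, 0 < s x + ‖gradient s x‖ := by
    intro x hx
    rw [closure_eq_self_union_frontier] at hx
    rcases hx with hx | hx
    · linarith [(h.mem_iff x).1 hx, norm_nonneg (gradient s x)]
    · rw [(h.mem_frontier_iff x).1 hx, zero_add]
      exact norm_pos_iff.2 (h.gradient_ne x hx)
  obtain ⟨c, hc0, hcl⟩ := hK.exists_forall_le' hc.continuousOn (a := 0) hpos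
  refine ⟨c / 2, by positivity, fun x hx => ?_⟩
  by_contra! hcon
  linarith [hcl x hx]

end IsDefFun

end Geometry

section Barriers

variable {N : ℕ} {Ω : Set (Euc N)} {f : Euc N → ℝ} {lam m : ℝ} {w : Euc N → ℝ}

lemma IsViscSub.statOp_le (hw : IsViscSub Ω f lam m w) {φ : Euc N → ℝ} {x : Euc N} (hx : x ∈ Ω)
    (hφ : ContDiffAt ℝ 2 φ x) (h : IsLocalMax (fun y => w y - φ y) x) :
    eikOp m φ x + lam * w x ≤ f x := by
  obtain ⟨ψ, hψ, e⟩ := exists_contDiff_eventuallyEq hφ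
  have h1 : IsLocalMax (fun y => w y - ψ y) x := by
    filter_upwards [h, e] with y hy ey
    rw [ey, e.eq_of_nhds]
    exact hy
  have h2 := hw ψ hψ x hx h1
  rw [statOp_congr e, statOp_eq] at h2
  linarith

lemma isViscSub_of_contDiffAt {φ : Euc N → ℝ}
    (h : ∀ x ∈ Ω, ContDiffAt ℝ 2 φ x ∧ eikOp m φ x + lam * φ x ≤ f x) : IsViscSub Ω f lam m φ := by
  intro ψ hψ x hx hmax
  have := eikOp_le_of_isLocalMax_sub (m := m) (h x hx).1 hψ.contDiffAt hmax
  rw [statOp_eq]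
  linarith [(h x hx).2]

/-- Radial profile of the boundary barrier. -/
noncomputable def bdryProfile (m M κ t : ℝ) : ℝ :=
  -(M / ((m - 2) / (m - 1))) * t ^ ((m - 2) / (m - 1)) + κ * t⁻¹

lemma hasDerivAt_bdryProfile (hm : 2 < m) (M κ : ℝ) {t : ℝ} (ht : 0 < t) :
    HasDerivAt (bdryProfile m M κ)
      (-(M * t ^ ((m - 2) / (m - 1) - 1) + κ * (t ^ 2)⁻¹)) t := by
  have ha : (m - 2) / (m - 1) ≠ 0 := by
    have : 0 < (m - 2) / (m - 1) := div_pos (by linarith) (by linarith)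
    exact this.ne'
  have h1 := ((Real.hasDerivAt_rpow_const (p := (m - 2) / (m - 1)) (Or.inl ht.ne')).const_mul
    (-(M / ((m - 2) / (m - 1))))).add ((hasDerivAt_inv ht.ne').const_mul κ)
  refine h1.congr_deriv ?_
  generalize (m - 2) / (m - 1) = a at *
  field_simp
  ring

lemma hasDerivAt_deriv_bdryProfile (M κ : ℝ) {t : ℝ} (ht : 0 < t) :
    HasDerivAt (fun t : ℝ => -(M * t ^ ((m - 2) / (m - 1) - 1) + κ * (t ^ 2)⁻¹))
      (M * (1 - (m - 2) / (m - 1)) * t ^ ((m - 2) / (m - 1) - 2) + 2 * κ * (t ^ 3)⁻¹) t := by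
  have h1 := (((Real.hasDerivAt_rpow_const (p := (m - 2) / (m - 1) - 1)
    (Or.inl ht.ne')).const_mul M).add
      (((hasDerivAt_pow 2 t).inv (by positivity)).const_mul κ)).neg
  refine h1.congr_deriv ?_
  rw [show (m - 2) / (m - 1) - 1 - 1 = (m - 2) / (m - 1) - 2 by ring]
  generalize (m - 2) / (m - 1) = a at *
  field_simp
  ring

lemma exponent_mul (hm : 2 < m) : ((m - 2) / (m - 1) - 1) * (m - 1) = -1 := by
  have : m - 1 ≠ 0 := by linarith
  field_simp
  ring

set_option maxHeartbeats 1000000 in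
/-- Existence of a boundary barrier, uniformly in the blow-up parameter `κ`. -/
lemma IsDefFun.exists_barrier {s : Euc N → ℝ} (h : IsDefFun Ω s) (hb : Bornology.IsBounded Ω)
    (hm : 2 < m) : ∃ M > 0, ∃ C₀ ≥ 0, ∀ κ, 0 < κ → κ ≤ 1 → ∀ x ∈ Ω,
      -C₀ ≤ eikOp m (fun y => bdryProfile m M κ (s y)) x := by
  have hK : IsCompact (closure Ω) := hb.isCompact_closure
  have cg : Continuous (gradient s) :=
    continuous_iff_continuousAt.2 fun x => continuousAt_gradient h.contDiff.contDiffAt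
  have cl : Continuous (lapl s) :=
    continuous_iff_continuousAt.2 fun x => continuousAt_lapl h.contDiff.contDiffAt
  obtain ⟨G', hG'⟩ := hK.exists_bound_of_continuousOn cg.continuousOn
  obtain ⟨D', hD'⟩ := hK.exists_bound_of_continuousOn cl.continuousOn
  obtain ⟨S', hS'⟩ := hK.exists_bound_of_continuousOn h.contDiff.continuous.continuousOn
  obtain ⟨c, hc, hcl⟩ := h.exists_le_or_le hb
  set G := max G' 0
  set D := max D' 0
  set S := max S' 0
  have hG0 : 0 ≤ G := le_max_right _ _
  have hD0 : 0 ≤ D := le_max_right _ _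
  have hS0 : 0 ≤ S := le_max_right _ _
  set Q := 2 * G ^ 2 + D * S + 1 with hQ
  have hQ0 : 0 < Q := by positivity
  set M := (Q / c ^ m) ^ (m - 1)⁻¹ with hM
  have hM0 : 0 < M := by positivity
  have hMm : M ^ (m - 1) * c ^ m = Q := by
    rw [hM, Real.rpow_inv_rpow (by positivity) (by linarith)]
    field_simp
  set a := (m - 2) / (m - 1) with ha
  have ha0 : 0 < a := div_pos (by linarith) (by linarith)
  have ha1 : a < 1 := (div_lt_one (by linarith)).2 (by linarith)
  set P₀ := M * c ^ (a - 1) + (c ^ 2)⁻¹ with hP₀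
  have hP₀0 : 0 < P₀ := by positivity
  refine ⟨M, hM0, 2 * P₀ / c * G ^ 2 + P₀ * D, by positivity, fun κ hκ hκ1 x hx => ?_⟩
  have hxc := subset_closure hx
  have ht : 0 < s x := (h.mem_iff x).1 hx
  set t := s x with htdef
  have hg : ‖gradient s x‖ ≤ G := (hG' x hxc).trans (le_max_left _ _)
  have hd : |lapl s x| ≤ D := (hD' x hxc).trans (le_max_left _ _)
  have hst : t ≤ S := (le_abs_self _).trans ((hS' x hxc).trans (le_max_left _ _))
  set P := M * t ^ (a - 1) + κ * (t ^ 2)⁻¹ with hP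
  have hP0 : 0 < P := by positivity
  set F2 := M * (1 - a) * t ^ (a - 2) + 2 * κ * (t ^ 3)⁻¹ with hF2
  have e1 : eikOp m (fun y => bdryProfile m M κ (s y)) x =
      -F2 * ‖gradient s x‖ ^ 2 + P * lapl s x + P ^ m * ‖gradient s x‖ ^ m := by
    rw [eikOp, lapl_comp (F := bdryProfile m M κ)
        (F' := fun t : ℝ => -(M * t ^ (a - 1) + κ * (t ^ 2)⁻¹)) (c := F2) h.contDiff.contDiffAt ?_
        (hasDerivAt_deriv_bdryProfile M κ ht),
      gradient_comp (F := bdryProfile m M κ) h.contDiff.contDiffAt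
        (hasDerivAt_bdryProfile hm M κ ht), norm_smul, norm_neg, Real.norm_of_nonneg hP0.le,
      Real.mul_rpow hP0.le (norm_nonneg _)]
    · ring
    · filter_upwards [lt_mem_nhds ht] with y hy using hasDerivAt_bdryProfile hm M κ hy
  have hF2le : F2 ≤ 2 * P / t := by
    have e2 : t ^ (a - 2) = t ^ (a - 1) / t := by
      rw [show a - 2 = a - 1 - 1 by ring, Real.rpow_sub_one ht.ne']
    have e3 : F2 = (M * (1 - a) * t ^ (a - 1) + 2 * κ * (t ^ 2)⁻¹) / t := by
      rw [hF2, e2]; field_simp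
    rw [e3, hP]
    gcongr
    have : 0 < M * t ^ (a - 1) := by positivity
    nlinarith
  have hPl : -(P * D) ≤ P * lapl s x := by
    have := (abs_le.1 hd).1
    nlinarith
  rw [e1]
  rcases hcl x hxc with hs | hs
  · have hPP : P ≤ P₀ := by
      have i1 : t ^ (a - 1) ≤ c ^ (a - 1) :=
        Real.rpow_le_rpow_of_nonpos hc hs (by linarith)
      have i2 : (t ^ 2)⁻¹ ≤ (c ^ 2)⁻¹ := by gcongr
      have i3 : κ * (t ^ 2)⁻¹ ≤ (t ^ 2)⁻¹ := mul_le_of_le_one_left (by positivity) hκ1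
      have i4 : M * t ^ (a - 1) ≤ M * c ^ (a - 1) := by gcongr
      linarith
    have i5 : F2 * ‖gradient s x‖ ^ 2 ≤ 2 * P₀ / c * G ^ 2 := by
      have : F2 ≤ 2 * P₀ / c := hF2le.trans (by gcongr)
      gcongr
    have i6 : P * D ≤ P₀ * D := by gcongr
    have i7 : 0 ≤ P ^ m * ‖gradient s x‖ ^ m := by positivity
    linarith
  · have j1 : M ^ (m - 1) / t ≤ P ^ (m - 1) := by
      have : (M * t ^ (a - 1)) ^ (m - 1) = M ^ (m - 1) / t := by
        rw [Real.mul_rpow hM0.le (by positivity), ← Real.rpow_mul ht.le, exponent_mul hm,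
          Real.rpow_neg_one, div_eq_mul_inv]
      rw [← this]
      refine Real.rpow_le_rpow (by positivity) ?_ (by linarith)
      have : 0 ≤ κ * (t ^ 2)⁻¹ := by positivity
      linarith
    have j2 : P ^ m = P * P ^ (m - 1) := by
      rw [Real.rpow_sub_one hP0.ne']; field_simp
    have j3 : c ^ m ≤ ‖gradient s x‖ ^ m := Real.rpow_le_rpow hc.le hs (by linarith)
    have j4 : P * (Q / t) ≤ P ^ m * ‖gradient s x‖ ^ m := by
      rw [j2, mul_assoc]
      gcongr
      calc Q / t = M ^ (m - 1) / t * c ^ m := by rw [← hMm]; ring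
        _ ≤ _ := by gcongr
    have j5 : F2 * ‖gradient s x‖ ^ 2 ≤ 2 * P / t * G ^ 2 := by gcongr
    have j6 : P * D ≤ P * (D * S / t) := by
      gcongr
      rw [le_div_iff₀ ht]
      gcongr
    have j7 : P * (Q / t) = 2 * P / t * G ^ 2 + P * (D * S / t) + P / t := by
      rw [hQ]; field_simp
    have j8 : 0 < P / t := by positivity
    have j9 : 0 ≤ 2 * P₀ / c * G ^ 2 + P₀ * D := by positivity
    linarith

/-- Upper bound for every continuous subsolution, uniform in `λ`. -/
lemma IsDefFun.exists_upper_bound {s : Euc N → ℝ} (h : IsDefFun Ω s) (hb : Bornology.IsBounded Ω)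
    (hm : 2 < m) (hf : ContinuousOn f (closure Ω)) : ∃ M > 0, ∃ K > 0, ∀ lam, 0 < lam → lam < 1 →
      ∀ w, ContinuousOn w (closure Ω) → IsViscSub Ω f lam m w → ∀ x ∈ Ω,
        w x ≤ -(M / ((m - 2) / (m - 1))) * s x ^ ((m - 2) / (m - 1)) + K / lam := by
  have hK : IsCompact (closure Ω) := hb.isCompact_closure
  obtain ⟨M, hM, C₀, hC₀, hbar⟩ := h.exists_barrier hb hm
  obtain ⟨F', hF'⟩ := hK.exists_bound_of_continuousOn hf
  obtain ⟨S', hS'⟩ := hK.exists_bound_of_continuousOn h.contDiff.continuous.continuousOn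
  set F := max F' 0
  set S := max S' 0
  have hF0 : 0 ≤ F := le_max_right _ _
  have hS0 : 0 ≤ S := le_max_right _ _
  set a := (m - 2) / (m - 1) with ha
  have ha0 : 0 < a := div_pos (by linarith) (by linarith)
  set B := M / a * S ^ a with hB
  have hB0 : 0 ≤ B := by positivity
  have hsS : ∀ x ∈ closure Ω, s x ≤ S := fun x hx =>
    (le_abs_self _).trans ((hS' x hx).trans (le_max_left _ _))
  have hsB : ∀ x ∈ closure Ω, M / a * s x ^ a ≤ B := fun x hx => by
    have := hsS x hx
    have := (h.mem_closure_iff x).1 hx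
    rw [hB]
    gcongr
  refine ⟨M, hM, F + C₀ + B + 1, by positivity, fun lam hl hl1 w hwc hw x hx => ?_⟩
  obtain ⟨W, hW⟩ := hK.exists_bound_of_continuousOn hwc
  have ht := (h.mem_iff x).1 hx
  have key : ∀ κ, 0 < κ → κ ≤ 1 → w x ≤ bdryProfile m M κ (s x) + (F + C₀ + B + 1) / lam := by
    intro κ hκ hκ1
    set v := w x - bdryProfile m M κ (s x) with hv
    obtain ⟨ε, hε, hεt, hεW⟩ : ∃ ε > 0, ε ≤ s x ∧ W - v + B < κ * ε⁻¹ := by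
      refine ⟨min (s x) (κ / (|W - v + B| + 1)), by positivity, min_le_left _ _, ?_⟩
      have i1 : (κ / (|W - v + B| + 1))⁻¹ ≤ (min (s x) (κ / (|W - v + B| + 1)))⁻¹ := by
        gcongr; exact min_le_right _ _
      have i2 : κ * (κ / (|W - v + B| + 1))⁻¹ = |W - v + B| + 1 := by
        field_simp
      have i3 := mul_le_mul_of_nonneg_left i1 hκ.le
      linarith [le_abs_self (W - v + B)]
    have hKε : IsCompact (closure Ω ∩ {y | ε ≤ s y}) :=
      hK.inter_right (isClosed_le continuous_const h.contDiff.continuous)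
    have hcont : ContinuousOn (fun y => w y - bdryProfile m M κ (s y))
        (closure Ω ∩ {y | ε ≤ s y}) := by
      refine (hwc.mono inter_subset_left).sub fun y hy => ContinuousAt.continuousWithinAt ?_
      have hy0 : 0 < s y := hε.trans_le hy.2
      exact ContinuousAt.comp (g := bdryProfile m M κ)
        (hasDerivAt_bdryProfile hm M κ hy0).continuousAt h.contDiff.continuous.continuousAt
    obtain ⟨x₀, hx₀, hmax⟩ := hKε.exists_isMaxOn ⟨x, subset_closure hx, hεt⟩ hcont
    have hx₀s : 0 < s x₀ := hε.trans_le hx₀.2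
    have hx₀Ω : x₀ ∈ Ω := (h.mem_iff x₀).2 hx₀s
    have hxv : v ≤ w x₀ - bdryProfile m M κ (s x₀) := hmax ⟨subset_closure hx, hεt⟩
    have hglob : ∀ y ∈ Ω, w y - bdryProfile m M κ (s y) ≤ w x₀ - bdryProfile m M κ (s x₀) := by
      intro y hy
      by_cases hys : ε ≤ s y
      · exact hmax ⟨subset_closure hy, hys⟩
      · push Not at hys
        refine le_trans ?_ hxv
        have hy0 := (h.mem_iff y).1 hy
        have i1 := (le_abs_self _).trans (hW y (subset_closure hy))
        have i2 := hsB y (subset_closure hy)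
        have i3 : κ * ε⁻¹ ≤ κ * (s y)⁻¹ := by gcongr
        simp only [bdryProfile, ← ha]
        linarith
    have hΩo : Ω ∈ 𝓝 x₀ := by
      have : {y | 0 < s y} ∈ 𝓝 x₀ := lt_mem_nhds hx₀s |> h.contDiff.continuous.continuousAt.eventually
      filter_upwards [this] with y hy using (h.mem_iff y).2 hy
    have hloc : IsLocalMax (fun y => w y - bdryProfile m M κ (s y)) x₀ := by
      filter_upwards [hΩo] with y hy using hglob y hy
    have hsm : ContDiffAt ℝ 2 (fun y => bdryProfile m M κ (s y)) x₀ := by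
      refine (contDiffAt_const.mul ?_).add (contDiffAt_const.mul ?_)
      · exact h.contDiff.contDiffAt.rpow_const_of_ne hx₀s.ne'
      · exact h.contDiff.contDiffAt.inv hx₀s.ne'
    have h1 := hw.statOp_le hx₀Ω hsm hloc
    have h2 := hbar κ hκ hκ1 x₀ hx₀Ω
    have h3 : f x₀ ≤ F := (le_abs_self _).trans
      ((hF' x₀ (subset_closure hx₀Ω)).trans (le_max_left _ _))
    have h4 : w x₀ ≤ (F + C₀) / lam := by
      rw [le_div_iff₀ hl]; linarith
    have h5 : -B ≤ bdryProfile m M κ (s x₀) := by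
      have := hsB x₀ (subset_closure hx₀Ω)
      have : 0 ≤ κ * (s x₀)⁻¹ := by positivity
      simp only [bdryProfile, ← ha]
      linarith
    have h6 : (F + C₀ + B + 1) / lam = (F + C₀) / lam + (B + 1) / lam := by ring
    have h7 : B + 1 ≤ (B + 1) / lam := by
      rw [le_div_iff₀ hl]; nlinarith
    linarith
  have hlim : Tendsto (fun κ => bdryProfile m M κ (s x) + (F + C₀ + B + 1) / lam) (𝓝[>] 0)
      (𝓝 (bdryProfile m M 0 (s x) + (F + C₀ + B + 1) / lam)) := by
    have : Continuous fun κ => bdryProfile m M κ (s x) + (F + C₀ + B + 1) / lam := by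
      unfold bdryProfile; fun_prop
    exact this.continuousAt.tendsto.mono_left nhdsWithin_le_nhds
  have := ge_of_tendsto hlim (by
    filter_upwards [Ioc_mem_nhdsGT (zero_lt_one' ℝ)] with κ hκ using key κ hκ.1 hκ.2)
  simpa [bdryProfile] using this

end Barriers

section HolderEstimate

variable {N : ℕ} {Ω : Set (Euc N)} {f : Euc N → ℝ} {lam m : ℝ} {w : Euc N → ℝ}

/-- Radial profile of the barrier on balls. -/
noncomputable def ballProfile (a t : ℝ) : ℝ := t ^ (a / 2) - Real.log (1 - t)

lemma hasDerivAt_ballProfile (a : ℝ) {t : ℝ} (ht : 0 < t) (ht1 : t < 1) :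
    HasDerivAt (ballProfile a) (a / 2 * t ^ (a / 2 - 1) + (1 - t)⁻¹) t := by
  have h1 := (Real.hasDerivAt_rpow_const (p := a / 2) (Or.inl ht.ne')).sub
    (((hasDerivAt_id t).const_sub 1).log (by simp only [id]; linarith))
  refine h1.congr_deriv ?_
  simp only [id]
  ring

lemma hasDerivAt_deriv_ballProfile (a : ℝ) {t : ℝ} (ht : 0 < t) (ht1 : t < 1) :
    HasDerivAt (fun t => a / 2 * t ^ (a / 2 - 1) + (1 - t)⁻¹)
      (a / 2 * (a / 2 - 1) * t ^ (a / 2 - 2) + ((1 - t) ^ 2)⁻¹) t := by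
  have h1 := ((Real.hasDerivAt_rpow_const (p := a / 2 - 1) (Or.inl ht.ne')).const_mul (a / 2)).add
    (((hasDerivAt_id t).const_sub 1).inv (by simp only [id]; linarith))
  refine h1.congr_deriv ?_
  rw [show a / 2 - 1 - 1 = a / 2 - 2 by ring]
  simp only [id]
  rw [neg_neg, one_div]
  ring

set_option maxHeartbeats 1000000 in
lemma exists_ball_barrier (N : ℕ) (hm : 2 < m) {A : ℝ} (hA : 0 ≤ A) : ∃ K ≥ 1, ∀ r, 0 < r → r ≤ 1 →
    ∀ y x : Euc N, x ≠ y → ‖x - y‖ < r → A ≤ eikOp m (fun x => K * r ^ ((m - 2) / (m - 1)) *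
      ballProfile ((m - 2) / (m - 1)) ((r ^ 2)⁻¹ * ‖x - y‖ ^ 2)) x := by
  set a := (m - 2) / (m - 1) with ha
  have ha0 : 0 < a := div_pos (by linarith) (by linarith)
  have ha1 : a < 1 := (div_lt_one (by linarith)).2 (by linarith)
  set C₁ := (2 * a ^ (m - 1))⁻¹ with hC₁
  have hC₁0 : 0 < C₁ := by positivity
  set K := 1 + (1 + 2 * N + A) * C₁ with hK
  have hK1 : 1 ≤ K := by
    have : 0 ≤ (1 + 2 * N + A) * C₁ := by positivity
    linarith
  have hK0 : 0 < K := by linarith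
  refine ⟨K, hK1, fun r hr hr1 y x hxy hxr => ?_⟩
  set t := (r ^ 2)⁻¹ * ‖x - y‖ ^ 2 with ht
  have hn0 : 0 < ‖x - y‖ := norm_pos_iff.2 (sub_ne_zero.2 hxy)
  have ht0 : 0 < t := by positivity
  have ht1 : t < 1 := by
    rw [ht, inv_mul_lt_iff₀ (by positivity), mul_one]
    gcongr
  set q := (1 - t)⁻¹ with hq
  have hq1 : 1 ≤ q := (one_le_inv₀ (by linarith)).2 (by linarith)
  set P := a / 2 * t ^ (a / 2 - 1) + q with hP
  have hP1 : q ≤ P := by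
    have : 0 ≤ a / 2 * t ^ (a / 2 - 1) := by positivity
    linarith
  have hP0 : 0 < P := by linarith
  set F2 := a / 2 * (a / 2 - 1) * t ^ (a / 2 - 2) + ((1 - t) ^ 2)⁻¹ with hF2
  have hF2q : F2 ≤ q ^ 2 := by
    have : 0 ≤ a / 2 * (1 - a / 2) * t ^ (a / 2 - 2) :=
      mul_nonneg (mul_nonneg (by linarith) (by linarith)) (by positivity)
    rw [hF2, hq, inv_pow]
    linarith
  set g := 2 * √t * P with hg
  have hst : 0 < √t := Real.sqrt_pos.2 ht0
  have hg0 : 0 < g := by positivity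
  have hσc : ContDiff ℝ 2 fun x : Euc N => (r ^ 2)⁻¹ * ‖x - y‖ ^ 2 :=
    contDiff_const.mul (contDiff_normSq y)
  have hgσ : gradient (fun x : Euc N => (r ^ 2)⁻¹ * ‖x - y‖ ^ 2) x =
      ((r ^ 2)⁻¹ * 2) • (x - y) := by
    rw [gradient_const_mul _ (contDiff_normSq y).contDiffAt, gradient_normSq, smul_smul]
  have hlσ : lapl (fun x : Euc N => (r ^ 2)⁻¹ * ‖x - y‖ ^ 2) x = (r ^ 2)⁻¹ * (2 * N) := by
    rw [lapl_const_mul _ (contDiff_normSq y).contDiffAt, lapl_normSq]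
  have hnσ : ‖((r ^ 2)⁻¹ * 2) • (x - y)‖ = 2 * √t / r := by
    have : √t = ‖x - y‖ / r := by
      rw [ht, ← inv_pow, ← mul_pow, Real.sqrt_sq (by positivity)]
      ring
    rw [norm_smul, this, Real.norm_of_nonneg (by positivity)]
    field_simp
  obtain ⟨V, hV, hVn⟩ : ∃ V, gradient (fun x : Euc N => (r ^ 2)⁻¹ * ‖x - y‖ ^ 2) x = V ∧
      ‖V‖ = 2 * √t / r := ⟨_, hgσ, hnσ⟩
  have hev : ∀ᶠ τ in 𝓝 t, HasDerivAt (ballProfile a) (a / 2 * τ ^ (a / 2 - 1) + (1 - τ)⁻¹) τ := by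
    filter_upwards [lt_mem_nhds ht0, gt_mem_nhds ht1] with τ h0 h1
    exact hasDerivAt_ballProfile a h0 h1
  have hBc : ContDiffAt ℝ 2 (fun x : Euc N => ballProfile a ((r ^ 2)⁻¹ * ‖x - y‖ ^ 2)) x := by
    refine (hσc.contDiffAt.rpow_const_of_ne ht0.ne').sub
      ((contDiffAt_const.sub hσc.contDiffAt).log ?_)
    change 1 - t ≠ 0
    linarith
  have e1 : eikOp m (fun x => K * r ^ a * ballProfile a ((r ^ 2)⁻¹ * ‖x - y‖ ^ 2)) x =
      -(K * r ^ a * (F2 * (2 * √t / r) ^ 2 + P * ((r ^ 2)⁻¹ * (2 * N)))) +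
        (K * r ^ a * (P * (2 * √t / r))) ^ m := by
    rw [eikOp, lapl_const_mul _ hBc, gradient_const_mul _ hBc,
      lapl_comp (F := ballProfile a) (s := fun x : Euc N => (r ^ 2)⁻¹ * ‖x - y‖ ^ 2)
        (F' := fun τ => a / 2 * τ ^ (a / 2 - 1) + (1 - τ)⁻¹)
        hσc.contDiffAt hev (hasDerivAt_deriv_ballProfile a ht0 ht1),
      gradient_comp (F := ballProfile a) (s := fun x : Euc N => (r ^ 2)⁻¹ * ‖x - y‖ ^ 2)
        hσc.contDiffAt (hasDerivAt_ballProfile a ht0 ht1), hV, hlσ, norm_smul, norm_smul, hVn,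
      Real.norm_of_nonneg (by positivity : 0 ≤ K * r ^ a), Real.norm_of_nonneg hP0.le]
  have hpow : (r ^ a * r⁻¹) ^ m = r ^ (a - 2) := by
    rw [← Real.rpow_neg_one r, ← Real.rpow_add hr, ← Real.rpow_mul hr.le]
    congr 1
    have : m - 1 ≠ 0 := by linarith
    rw [ha]; field_simp; ring
  have hpow2 : r ^ a * (r ^ 2)⁻¹ = r ^ (a - 2) := by
    rw [Real.rpow_sub hr, Real.rpow_two]; rfl
  have e2 : eikOp m (fun x => K * r ^ a * ballProfile a ((r ^ 2)⁻¹ * ‖x - y‖ ^ 2)) x =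
      r ^ (a - 2) * (K * (K ^ (m - 1) * g ^ m - 4 * t * F2 - 2 * N * P)) := by
    have i1 : K * r ^ a * (P * (2 * √t / r)) = K * (r ^ a * r⁻¹) * g := by rw [hg]; ring
    have i2 : (2 * √t / r) ^ 2 = 4 * t * (r ^ 2)⁻¹ := by
      rw [div_pow, mul_pow, Real.sq_sqrt ht0.le]; ring
    have i3 : K ^ m = K * K ^ (m - 1) := by
      rw [Real.rpow_sub_one hK0.ne']; field_simp
    rw [e1, i1, i2, Real.mul_rpow (by positivity) hg0.le, Real.mul_rpow hK0.le (by positivity),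
      hpow, ← hpow2, i3]
    ring
  have hgm : P ≤ C₁ * g ^ m := by
    have j1 : a * t ^ ((a - 1) / 2) ≤ g := by
      have k1 : √t * t ^ (a / 2 - 1) = t ^ ((a - 1) / 2) := by
        rw [Real.sqrt_eq_rpow, ← Real.rpow_add ht0]; congr 1; ring
      calc a * t ^ ((a - 1) / 2) = 2 * √t * (a / 2 * t ^ (a / 2 - 1)) := by rw [← k1]; ring
        _ ≤ g := by rw [hg, hP]; gcongr; linarith
    have j2 : a ^ (m - 1) * (√t)⁻¹ ≤ g ^ (m - 1) := by
      have k2 : (a * t ^ ((a - 1) / 2)) ^ (m - 1) = a ^ (m - 1) * (√t)⁻¹ := by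
        rw [Real.mul_rpow ha0.le (by positivity), ← Real.rpow_mul ht0.le, Real.sqrt_eq_rpow,
          ← Real.rpow_neg ht0.le]
        congr 2
        linear_combination (1 / 2) * exponent_mul hm
      rw [← k2]
      exact Real.rpow_le_rpow (by positivity) j1 (by linarith)
    have j3 : g ^ m = g * g ^ (m - 1) := by
      rw [Real.rpow_sub_one hg0.ne']; field_simp
    rw [hC₁, inv_mul_eq_div, le_div_iff₀ (by positivity), j3]
    calc P * (2 * a ^ (m - 1)) = g * (a ^ (m - 1) * (√t)⁻¹) := by rw [hg]; field_simp
      _ ≤ _ := by gcongr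
  have hq2 : 4 * t * F2 ≤ g ^ m + P := by
    have j1 : 4 * t * F2 ≤ g ^ 2 := by
      calc 4 * t * F2 ≤ 4 * t * P ^ 2 := by
            have : F2 ≤ P ^ 2 := hF2q.trans (by gcongr)
            gcongr
        _ = g ^ 2 := by rw [hg, mul_pow, mul_pow, Real.sq_sqrt ht0.le]; ring
    rcases le_total 1 g with h1 | h1
    · have : g ^ 2 ≤ g ^ m := by
        rw [← Real.rpow_two]; exact Real.rpow_le_rpow_of_exponent_le h1 hm.le
      linarith
    · have : g ^ 2 ≤ 1 := pow_le_one₀ hg0.le h1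
      have : 0 ≤ g ^ m := by positivity
      linarith
  have hKm : K ≤ K ^ (m - 1) := by
    conv_lhs => rw [← Real.rpow_one K]
    exact Real.rpow_le_rpow_of_exponent_le hK1 (by linarith)
  have hmain : A ≤ K ^ (m - 1) * g ^ m - 4 * t * F2 - 2 * N * P := by
    have k1 : K * g ^ m ≤ K ^ (m - 1) * g ^ m := by gcongr
    have k2 : (1 + 2 * N + A) * P ≤ (1 + 2 * N + A) * (C₁ * g ^ m) := by gcongr
    have k3 : K * g ^ m = g ^ m + (1 + 2 * N + A) * (C₁ * g ^ m) := by rw [hK]; ring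
    have k4 : A ≤ A * P := le_mul_of_one_le_right hA (hq1.trans hP1)
    linarith
  rw [e2]
  have hr2 : 1 ≤ r ^ (a - 2) := Real.one_le_rpow_of_pos_of_le_one_of_nonpos hr hr1 (by linarith)
  calc A ≤ K ^ (m - 1) * g ^ m - 4 * t * F2 - 2 * N * P := hmain
    _ ≤ K * (K ^ (m - 1) * g ^ m - 4 * t * F2 - 2 * N * P) :=
      le_mul_of_one_le_left (hA.trans hmain) hK1
    _ ≤ _ := le_mul_of_one_le_left (mul_nonneg hK0.le (hA.trans hmain)) hr2

/-- One-sided Hölder estimate on balls for subsolutions. -/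
lemma exists_ball_estimate (N : ℕ) (hm : 2 < m) {A : ℝ} (hA : 0 ≤ A) : ∃ C > 0,
    ∀ (Ω : Set (Euc N)) (f w : Euc N → ℝ) (lam : ℝ), Bornology.IsBounded Ω →
      ContinuousOn w (closure Ω) → IsViscSub Ω f lam m w → (∀ x ∈ Ω, f x - lam * w x < A) →
      ∀ y r, 0 < r → r ≤ 1 → ball y r ⊆ Ω → ∀ x, ‖x - y‖ ≤ r / 2 →
        w x - w y ≤ C * r ^ ((m - 2) / (m - 1)) := by
  obtain ⟨K, hK1, hbar⟩ := exists_ball_barrier N hm hA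
  set a := (m - 2) / (m - 1) with ha
  have ha0 : 0 < a := div_pos (by linarith) (by linarith)
  refine ⟨K * 2, by linarith, fun Ω f w lam hb hwc hw hfA y r hr hr1 hball x hx => ?_⟩
  obtain ⟨W, hW⟩ := hb.isCompact_closure.exists_bound_of_continuousOn hwc
  set σ : Euc N → ℝ := fun x => (r ^ 2)⁻¹ * ‖x - y‖ ^ 2 with hσ
  have hσ0 : ∀ x, 0 ≤ σ x := fun x => by positivity
  have hσc : ContDiff ℝ 2 σ := contDiff_const.mul (contDiff_normSq y)
  have hσr : ∀ x, σ x < 1 → ‖x - y‖ < r := fun x h => by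
    rw [hσ] at h
    simp only at h
    rw [inv_mul_lt_iff₀ (by positivity), mul_one] at h
    exact lt_of_pow_lt_pow_left₀ 2 hr.le h
  have hσΩ : ∀ x, σ x < 1 → x ∈ Ω := fun x h => hball (by
    rw [mem_ball, dist_eq_norm]; exact hσr x h)
  have hσx : σ x ≤ 1 / 4 := by
    rw [hσ]
    simp only
    rw [inv_mul_le_iff₀ (by positivity)]
    calc ‖x - y‖ ^ 2 ≤ (r / 2) ^ 2 := by gcongr
      _ = _ := by ring
  have hKr : 0 < K * r ^ a := by positivity
  set B : Euc N → ℝ := fun x => K * r ^ a * ballProfile a (σ x) with hB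
  have hBy : B y = 0 := by
    simp [hB, hσ, ballProfile, Real.zero_rpow (show a / 2 ≠ 0 by positivity)]
  have key : w x - B x ≤ w y := by
    set v := w x - B x with hv
    set ε := min (3 / 4) (Real.exp (-((|W - v| + 1) / (K * r ^ a)))) with hε
    have hε0 : 0 < ε := by positivity
    have hεlog : W - v < K * r ^ a * -Real.log ε := by
      have h1 : Real.log ε ≤ -((|W - v| + 1) / (K * r ^ a)) := by
        rw [← Real.log_exp (-((|W - v| + 1) / (K * r ^ a)))]
        exact Real.log_le_log hε0 (min_le_right _ _)
      have h2 : K * r ^ a * ((|W - v| + 1) / (K * r ^ a)) ≤ K * r ^ a * -Real.log ε := by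
        gcongr; linarith
      have h3 : K * r ^ a * ((|W - v| + 1) / (K * r ^ a)) = |W - v| + 1 := by field_simp
      linarith [le_abs_self (W - v)]
    have hlt : ∀ x, σ x ≤ 1 - ε → σ x < 1 := fun x h => by linarith
    have hKc : IsCompact {x | σ x ≤ 1 - ε} := by
      refine Metric.isCompact_of_isClosed_isBounded (isClosed_le hσc.continuous continuous_const)
        ((isBounded_ball (x := y) (r := r)).subset fun x hx => ?_)
      rw [mem_ball, dist_eq_norm]
      exact hσr x (hlt x hx)
    have hcont : ContinuousOn (fun x => w x - B x) {x | σ x ≤ 1 - ε} := by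
      refine (hwc.mono fun x hx => subset_closure (hσΩ x (hlt x hx))).sub
        (continuousOn_const.mul ((hσc.continuous.continuousOn.rpow_const
          fun _ _ => Or.inr (by positivity)).sub (ContinuousOn.log
            (continuousOn_const.sub hσc.continuous.continuousOn) fun x hx => ?_)))
      have := hlt x hx
      linarith
    have hxin : σ x ≤ 1 - ε := by linarith [min_le_left (3 / 4) (Real.exp (-((|W - v| + 1) / (K * r ^ a))))]
    obtain ⟨x₀, hx₀, hmax⟩ := hKc.exists_isMaxOn ⟨x, hxin⟩ hcont
    have hxv : v ≤ w x₀ - B x₀ := hmax hxin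
    rcases eq_or_ne x₀ y with rfl | hne
    · rwa [hBy, sub_zero] at hxv
    exfalso
    have hx₀1 : σ x₀ < 1 := hlt x₀ hx₀
    have hloc : IsLocalMax (fun x => w x - B x) x₀ := by
      filter_upwards [hσc.continuous.continuousAt.eventually (gt_mem_nhds hx₀1)] with z hz
      by_cases hzε : σ z ≤ 1 - ε
      · exact hmax hzε
      · push Not at hzε
        refine le_trans ?_ hxv
        have i1 := (le_abs_self _).trans (hW z (subset_closure (hσΩ z hz)))
        have i2 : Real.log (1 - σ z) ≤ Real.log ε := Real.log_le_log (by linarith) (by linarith)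
        have i3 : 0 ≤ σ z ^ (a / 2) := Real.rpow_nonneg (hσ0 z) _
        have i4 : K * r ^ a * -Real.log ε ≤ B z := by
          simp only [hB, ballProfile]
          gcongr
          linarith
        linarith
    have hn0 : 0 < ‖x₀ - y‖ := norm_pos_iff.2 (sub_ne_zero.2 hne)
    have hσ₀ : 0 < σ x₀ := by simp only [hσ]; positivity
    have hBc : ContDiffAt ℝ 2 B x₀ := by
      refine contDiffAt_const.mul ((hσc.contDiffAt.rpow_const_of_ne hσ₀.ne').sub
        ((contDiffAt_const.sub hσc.contDiffAt).log ?_))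
      linarith
    have h1 := hw.statOp_le (hσΩ x₀ hx₀1) hBc hloc
    have h2 : A ≤ eikOp m B x₀ := hbar r hr hr1 y x₀ hne (hσr x₀ hx₀1)
    linarith [hfA x₀ (hσΩ x₀ hx₀1)]
  have hB2 : B x ≤ K * 2 * r ^ a := by
    have h1 : ballProfile a (σ x) ≤ 2 := by
      have i1 : σ x ^ (a / 2) ≤ 1 := Real.rpow_le_one (hσ0 x) (by linarith) (by positivity)
      have i2 := Real.one_sub_inv_le_log_of_pos (show 0 < 1 - σ x by linarith)
      have i3 : (1 - σ x)⁻¹ ≤ (3 / 4)⁻¹ := by gcongr; linarith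
      rw [ballProfile]
      norm_num at i3
      linarith
    calc B x ≤ K * r ^ a * 2 := by simp only [hB]; gcongr
      _ = _ := by ring
  linarith

end HolderEstimate

section Equicontinuity

variable {N : ℕ} {Ω : Set (Euc N)}

/-- Continuous subsolutions are equicontinuous at every point of the closure of `Ω`. -/
lemma IsDefFun.exists_equicontinuity {s : Euc N → ℝ} (h : IsDefFun Ω s) (hΩ : IsOpen Ω)
    (hb : Bornology.IsBounded Ω) {m : ℝ} (hm : 2 < m) {A : ℝ} (hA : 0 ≤ A) {z : Euc N}
    (hz : z ∈ closure Ω) {ε : ℝ} (hε : 0 < ε) :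
    ∃ δ > 0, ∀ (f w : Euc N → ℝ) (lam : ℝ), ContinuousOn w (closure Ω) → IsViscSub Ω f lam m w →
      (∀ x ∈ Ω, f x - lam * w x < A) → ∀ x ∈ closure Ω, ‖x - z‖ ≤ δ → |w x - w z| ≤ ε := by
  obtain ⟨C, hC, hest⟩ := exists_ball_estimate N hm hA
  obtain ⟨n, hn, r, hr, hr1, hcone⟩ := h.exists_cone hΩ hz
  set a := (m - 2) / (m - 1) with ha
  have ha0 : 0 < a := div_pos (by linarith) (by linarith)
  set q : ℝ := 15 / 16 with hq
  have hqa : q ^ a < 1 := Real.rpow_lt_one (by norm_num) (by norm_num) ha0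
  set C' := C / (1 - q ^ a) with hC'
  have hC'0 : 0 < C' := div_pos hC (by linarith)
  obtain ⟨t, ht, htr, hte⟩ : ∃ t > 0, t ≤ r ∧ (2 * C' + C) * t ^ a ≤ ε := by
    have : Tendsto (fun t : ℝ => (2 * C' + C) * t ^ a) (𝓝[>] 0) (𝓝 0) := by
      have h1 : Continuous fun t : ℝ => (2 * C' + C) * t ^ a :=
        continuous_const.mul (Real.continuous_rpow_const ha0.le)
      have := (h1.tendsto 0).mono_left (nhdsWithin_le_nhds (s := Ioi 0))
      simpa [Real.zero_rpow ha0.ne'] using this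
    obtain ⟨t, h1, h2⟩ := ((this.eventually (gt_mem_nhds hε)).and (Ioc_mem_nhdsGT hr)).exists
    exact ⟨t, h2.1, h2.2, h1.le⟩
  refine ⟨t / 16, by positivity, fun f w lam hwc hw hfA => ?_⟩
  have hloc : ∀ x ∈ closure Ω, ‖x - z‖ ≤ r → ∀ τ, 0 < τ → τ ≤ r → ∀ x',
      ‖x' - (x + τ • n)‖ ≤ τ / 16 → |w x' - w (x + τ • n)| ≤ C * τ ^ a := by
    intro x hx hxz τ hτ hτr x' hx'
    have hball := hcone x hx hxz τ hτ hτr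
    have i1 := hest Ω f w lam hb hwc hw hfA (x + τ • n) (τ / 4) (by positivity) (by linarith) hball
      x' (by linarith)
    have i2 := hest Ω f w lam hb hwc hw hfA x' (τ / 8) (by positivity) (by linarith) (by
      refine Subset.trans (fun y hy => ?_) hball
      rw [← dist_eq_norm] at hx'
      rw [mem_ball] at hy ⊢
      linarith [dist_triangle y x' (x + τ • n)]) (x + τ • n) (by rw [norm_sub_rev]; linarith)
    have i3 : C * (τ / 4) ^ a ≤ C * τ ^ a := by gcongr; linarith
    have i4 : C * (τ / 8) ^ a ≤ C * τ ^ a := by gcongr; linarith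
    rw [abs_le]
    constructor <;> linarith
  have hchain : ∀ x ∈ closure Ω, ‖x - z‖ ≤ r → |w (x + t • n) - w x| ≤ C' * t ^ a := by
    intro x hx hxz
    have hτ : ∀ k : ℕ, 0 < t * q ^ k ∧ t * q ^ k ≤ t := fun k =>
      ⟨by positivity, mul_le_of_le_one_right ht.le (pow_le_one₀ (by positivity) (by norm_num))⟩
    have hstep : ∀ k : ℕ, dist (w (x + (t * q ^ k) • n)) (w (x + (t * q ^ (k + 1)) • n)) ≤
        C * t ^ a * (q ^ a) ^ k := by
      intro k
      have := hloc x hx hxz (t * q ^ k) (hτ k).1 ((hτ k).2.trans htr) (x + (t * q ^ (k + 1)) • n) (by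
        rw [add_sub_add_left_eq_sub, ← sub_smul, norm_smul, Real.norm_eq_abs]
        have e : t * q ^ (k + 1) - t * q ^ k = -(t * q ^ k / 16) := by rw [hq]; ring
        have := (hτ k).1
        rw [e, abs_neg, abs_of_nonneg (by positivity)]
        exact mul_le_of_le_one_right (by positivity) hn)
      rw [dist_comm, Real.dist_eq]
      refine this.trans_eq ?_
      rw [Real.mul_rpow ht.le (by positivity), ← Real.rpow_natCast_mul (by positivity),
        mul_comm (k : ℝ) a, Real.rpow_mul_natCast (by positivity), mul_assoc]
    have hlim : Tendsto (fun k : ℕ => w (x + (t * q ^ k) • n)) atTop (𝓝 (w x)) := by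
      refine (hwc x hx).tendsto.comp (tendsto_nhdsWithin_iff.2 ⟨?_, Eventually.of_forall fun k => ?_⟩)
      · have h1 : Tendsto (fun k : ℕ => q ^ k) atTop (𝓝 0) :=
          tendsto_pow_atTop_nhds_zero_of_lt_one (by norm_num) (by norm_num)
        have := ((h1.const_mul t).smul_const n).const_add x
        simpa using this
      · exact subset_closure (hcone x hx hxz _ (hτ k).1 ((hτ k).2.trans htr)
          (mem_ball_self (by linarith [(hτ k).1])))
    have := dist_le_of_le_geometric_of_tendsto₀ (q ^ a) (C * t ^ a) hqa hstep hlim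
    rw [Real.dist_eq] at this
    simp only [pow_zero, mul_one] at this
    refine this.trans_eq ?_
    rw [hC']; ring
  intro x hx hxz
  have h1 := hchain x hx (by linarith)
  have h2 := hchain z hz (by simpa using hr.le)
  have h3 := hloc z hz (by simpa using hr.le) t ht htr (x + t • n) (by
    rwa [add_sub_add_right_eq_sub])
  rw [abs_le] at *
  constructor <;> linarith [h1.1, h1.2, h2.1, h2.2, h3.1, h3.2]

end Equicontinuity

section Perron

variable {N : ℕ} {Ω : Set (Euc N)} {f : Euc N → ℝ} {lam m R L : ℝ}

/-- The class of subsolutions used in the Perron construction. -/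
structure IsAdmissible (Ω : Set (Euc N)) (f : Euc N → ℝ) (lam m R L : ℝ) (w : Euc N → ℝ) :
    Prop where
  continuousOn : ContinuousOn w (closure Ω)
  isViscSub : IsViscSub Ω f lam m w
  le_of_mem_frontier : ∀ x ∈ frontier Ω, w x ≤ R
  le_of_mem_closure : ∀ x ∈ closure Ω, -L ≤ w x

/-- The largest admissible subsolution. -/
noncomputable def perron (Ω : Set (Euc N)) (f : Euc N → ℝ) (lam m R L : ℝ) (x : Euc N) : ℝ :=
  sSup ((fun w : Euc N → ℝ => w x) '' {w | IsAdmissible Ω f lam m R L w})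

lemma eikOp_const (hm : 2 < m) (c : ℝ) (x : Euc N) : eikOp m (fun _ : Euc N => c) x = 0 := by
  simp [eikOp, lapl_const, gradient, Real.zero_rpow (show m ≠ 0 by linarith)]

lemma isAdmissible_const (hm : 2 < m) (hR : 0 < R) (hL : 0 ≤ L)
    (hf : ∀ x ∈ closure Ω, |f x| ≤ lam * L) : IsAdmissible Ω f lam m R L fun _ => -L where
  continuousOn := continuousOn_const
  isViscSub := isViscSub_of_contDiffAt fun x hx => ⟨contDiffAt_const, by
    rw [eikOp_const hm]
    have := (abs_le.1 (hf x (subset_closure hx))).1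
    linarith⟩
  le_of_mem_frontier := fun x _ => by linarith
  le_of_mem_closure := fun x _ => le_rfl

lemma eikOp_add_normSq (m : ℝ) {φ : Euc N → ℝ} {x₀ : Euc N} (hφ : ContDiffAt ℝ 2 φ x₀) (κ : ℝ) :
    eikOp m (fun x => φ x + κ * ‖x - x₀‖ ^ 2) x₀ = eikOp m φ x₀ - κ * (2 * N) := by
  have h := contDiff_normSq x₀
  rw [eikOp, lapl_add hφ (contDiff_const.mul h).contDiffAt, lapl_const_mul _ h.contDiffAt,
    lapl_normSq, gradient_add hφ (contDiff_const.mul h).contDiffAt,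
    gradient_const_mul _ h.contDiffAt, gradient_normSq, sub_self, smul_zero, smul_zero, add_zero,
    eikOp]
  ring

lemma eikOp_add_const (m : ℝ) {φ : Euc N → ℝ} {x : Euc N} (hφ : ContDiffAt ℝ 2 φ x) (c : ℝ) :
    eikOp m (fun x => φ x + c) x = eikOp m φ x := by
  rw [eikOp, lapl_add hφ contDiffAt_const, lapl_const, gradient_add hφ contDiffAt_const]
  simp [gradient, eikOp]

/-- Suprema of subsolutions are subsolutions. -/
lemma isViscSub_of_forall_exists {𝒮 : Set (Euc N → ℝ)} {u : Euc N → ℝ} (hΩ : IsOpen Ω) (hm : 2 < m)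
    (hl : 0 < lam) (hf : ContinuousOn f Ω) (h𝒮 : ∀ w ∈ 𝒮, ContinuousOn w Ω ∧ IsViscSub Ω f lam m w)
    (hle : ∀ w ∈ 𝒮, ∀ x ∈ Ω, w x ≤ u x) (hex : ∀ x ∈ Ω, ∀ η > 0, ∃ w ∈ 𝒮, u x - η < w x) :
    IsViscSub Ω f lam m u := by
  intro φ hφ x₀ hx₀ hmax
  by_contra! hpos
  rw [statOp_eq] at hpos
  obtain ⟨κ, hκ, hκ2⟩ := exists_pos_mul_lt hpos (2 * N)
  set ψ : Euc N → ℝ := fun x => φ x + κ * ‖x - x₀‖ ^ 2 with hψ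
  have hψc : ContDiff ℝ 2 ψ := hφ.add (contDiff_const.mul (contDiff_normSq x₀))
  have hψ0 : ψ x₀ = φ x₀ := by simp [hψ]
  set E : Euc N → ℝ := fun x => eikOp m ψ x + lam * (u x₀ + ψ x - ψ x₀) - f x with hE
  have hEc : ContinuousAt E x₀ :=
    ((continuousAt_eikOp (by linarith) hψc.contDiffAt).add (continuousAt_const.mul
      ((continuousAt_const.add hψc.continuous.continuousAt).sub continuousAt_const))).sub
        (hf.continuousAt (hΩ.mem_nhds hx₀))
  have hE0 : 0 < E x₀ := by
    simp only [hE]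
    rw [hψ, eikOp_add_normSq m hφ.contDiffAt]
    simp only [add_sub_cancel_right]
    linarith
  have hev : ∀ᶠ x in 𝓝 x₀, E x₀ / 2 < E x ∧ x ∈ Ω ∧ u x - φ x ≤ u x₀ - φ x₀ :=
    (hEc.eventually (lt_mem_nhds (by linarith))).and ((hΩ.eventually_mem hx₀).and hmax)
  obtain ⟨r, hr, hrb⟩ := Metric.nhds_basis_closedBall.eventually_iff.1 hev
  set η := min (κ * r ^ 2) (E x₀ / 2 / lam) with hη
  have hη0 : 0 < η := by positivity
  obtain ⟨w, hw𝒮, hwη⟩ := hex x₀ hx₀ η hη0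
  have hwc := (h𝒮 w hw𝒮).1
  have hsub : closedBall x₀ r ⊆ Ω := fun x hx => (hrb hx).2.1
  obtain ⟨x₁, hx₁, hmax₁⟩ := (isCompact_closedBall x₀ r).exists_isMaxOn
    ⟨x₀, mem_closedBall_self hr.le⟩ ((hwc.mono hsub).sub hψc.continuous.continuousOn)
  have h0 : w x₀ - ψ x₀ ≤ w x₁ - ψ x₁ := hmax₁ (mem_closedBall_self hr.le)
  have hin : x₁ ∈ ball x₀ r := by
    by_contra hn
    have hd : ‖x₁ - x₀‖ = r := by
      rw [mem_closedBall, dist_eq_norm] at hx₁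
      rw [mem_ball, dist_eq_norm] at hn
      linarith
    have i1 := (hrb hx₁).2.2
    have i2 := hle w hw𝒮 x₁ (hsub hx₁)
    have i3 : ψ x₁ = φ x₁ + κ * r ^ 2 := by simp only [hψ, hd]
    have i4 : η ≤ κ * r ^ 2 := min_le_left _ _
    linarith
  have hloc : IsLocalMax (fun x => w x - ψ x) x₁ := by
    filter_upwards [isOpen_ball.mem_nhds hin] with x hx using hmax₁ (ball_subset_closedBall hx)
  have h1 := (h𝒮 w hw𝒮).2.statOp_le (hsub hx₁) hψc.contDiffAt hloc
  have h2 := (hrb hx₁).1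
  have h3 : lam * η ≤ E x₀ / 2 := by
    have := mul_le_mul_of_nonneg_left (min_le_right (κ * r ^ 2) (E x₀ / 2 / lam)) hl.le
    rwa [mul_div_cancel₀ _ hl.ne'] at this
  have h4 : lam * (u x₀ + ψ x₁ - ψ x₀) ≤ lam * (w x₁ + η) := by
    gcongr
    linarith
  simp only [hE] at h2 h3
  linarith

lemma bddAbove_admissible {s : Euc N → ℝ} (h : IsDefFun Ω s) (hb : Bornology.IsBounded Ω)
    (hm : 2 < m) (hf : ContinuousOn f (closure Ω)) (hl : 0 < lam) (hl1 : lam < 1) {x : Euc N}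
    (hx : x ∈ closure Ω) :
    BddAbove ((fun w : Euc N → ℝ => w x) '' {w | IsAdmissible Ω f lam m R L w}) := by
  obtain ⟨M, hM, K, hK, hup⟩ := h.exists_upper_bound hb hm hf
  refine ⟨max R (K / lam), ?_⟩
  rintro _ ⟨w, hw, rfl⟩
  rw [closure_eq_self_union_frontier] at hx
  rcases hx with hx | hx
  · refine le_max_of_le_right ((hup lam hl hl1 w hw.continuousOn hw.isViscSub x hx).trans ?_)
    have h1 := (h.mem_iff x).1 hx
    have h2 : 0 < m - 2 := by linarith
    have h3 : 0 < m - 1 := by linarith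
    have : 0 ≤ M / ((m - 2) / (m - 1)) * s x ^ ((m - 2) / (m - 1)) := by positivity
    linarith
  · exact le_max_of_le_left (hw.le_of_mem_frontier x hx)

lemma IsAdmissible.le_perron {s : Euc N → ℝ} (h : IsDefFun Ω s) (hb : Bornology.IsBounded Ω)
    (hm : 2 < m) (hf : ContinuousOn f (closure Ω)) (hl : 0 < lam) (hl1 : lam < 1)
    {w : Euc N → ℝ} (hw : IsAdmissible Ω f lam m R L w) {x : Euc N} (hx : x ∈ closure Ω) :
    w x ≤ perron Ω f lam m R L x :=
  le_csSup (bddAbove_admissible h hb hm hf hl hl1 hx) ⟨w, hw, rfl⟩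

/-- The Perron function is itself admissible. -/
lemma isAdmissible_perron {s : Euc N → ℝ} (h : IsDefFun Ω s) (hΩ : IsOpen Ω)
    (hb : Bornology.IsBounded Ω) (hm : 2 < m) (hf : ContinuousOn f (closure Ω)) (hl : 0 < lam)
    (hl1 : lam < 1) (hR : 0 < R) (hL : 0 ≤ L) (hfL : ∀ x ∈ closure Ω, |f x| ≤ lam * L) :
    IsAdmissible Ω f lam m R L (perron Ω f lam m R L) := by
  set u := perron Ω f lam m R L with hu
  have hne : {w | IsAdmissible Ω f lam m R L w}.Nonempty := ⟨_, isAdmissible_const hm hR hL hfL⟩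
  have hle : ∀ w, IsAdmissible Ω f lam m R L w → ∀ x ∈ closure Ω, w x ≤ u x :=
    fun w hw x hx => hw.le_perron h hb hm hf hl hl1 hx
  have hlub : ∀ x c, (∀ w, IsAdmissible Ω f lam m R L w → w x ≤ c) → u x ≤ c := fun x c hc => by
    refine csSup_le (hne.image _) ?_
    rintro _ ⟨w, hw, rfl⟩
    exact hc w hw
  have hA : ∀ w, IsAdmissible Ω f lam m R L w → ∀ x ∈ Ω, f x - lam * w x < 2 * (lam * L) + 1 := by
    intro w hw x hx
    have i1 := (abs_le.1 (hfL x (subset_closure hx))).2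
    have i2 := mul_le_mul_of_nonneg_left (hw.le_of_mem_closure x (subset_closure hx)) hl.le
    linarith
  have hcont : ContinuousOn u (closure Ω) := by
    intro z hz
    rw [Metric.continuousWithinAt_iff]
    intro ε hε
    obtain ⟨δ, hδ, hequi⟩ := h.exists_equicontinuity hΩ hb hm
      (A := 2 * (lam * L) + 1) (by positivity) hz (half_pos hε)
    refine ⟨δ, hδ, fun x hx hxz => ?_⟩
    have hw : ∀ w, IsAdmissible Ω f lam m R L w → |w x - w z| ≤ ε / 2 := fun w hw =>
      hequi f w lam hw.continuousOn hw.isViscSub (hA w hw) x hx (by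
        rw [← dist_eq_norm]; exact hxz.le)
    have h1 : u x ≤ u z + ε / 2 := hlub x _ fun w hw' => by
      linarith [(abs_le.1 (hw w hw')).2, hle w hw' z hz]
    have h2 : u z ≤ u x + ε / 2 := hlub z _ fun w hw' => by
      linarith [(abs_le.1 (hw w hw')).1, hle w hw' x hx]
    rw [Real.dist_eq, abs_lt]
    constructor <;> linarith
  refine ⟨hcont, ?_, fun x hx => hlub x R fun w hw => hw.le_of_mem_frontier x hx, fun x hx => ?_⟩
  · refine isViscSub_of_forall_exists (𝒮 := {w | IsAdmissible Ω f lam m R L w}) hΩ hm hl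
      (hf.mono subset_closure) (fun w hw => ⟨hw.continuousOn.mono subset_closure, hw.isViscSub⟩)
      (fun w hw x hx => hle w hw x (subset_closure hx)) fun x _ η hη => ?_
    obtain ⟨_, ⟨w, hw, rfl⟩, hlt⟩ := exists_lt_of_lt_csSup (hne.image fun w : Euc N → ℝ => w x)
      (show u x - η < _ from sub_lt_self _ hη)
    exact ⟨w, hw, hlt⟩
  · exact hle _ (isAdmissible_const hm hR hL hfL) x hx

end Perron

section PerronSupersolution

variable {N : ℕ} {Ω : Set (Euc N)} {f : Euc N → ℝ} {lam m R L : ℝ}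

/-- A strict subsolution touching an admissible function from below at a point where the boundary
condition is not saturated allows to increase the admissible function. -/
lemma IsAdmissible.exists_bump (hΩ : IsOpen Ω) (hm : 2 < m) (hf : ContinuousOn f (closure Ω))
    (hl : 0 < lam) {u : Euc N → ℝ} (hu : IsAdmissible Ω f lam m R L u) {φ : Euc N → ℝ}
    (hφ : ContDiff ℝ 2 φ) {x₀ : Euc N} (hx₀ : x₀ ∈ closure Ω)
    (hmin : IsLocalMinOn (u - φ) (closure Ω) x₀) (hcase : x₀ ∈ Ω ∨ u x₀ < R)
    (hneg : statOp f lam m φ (u x₀) x₀ < 0) :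
    ∃ W, IsAdmissible Ω f lam m R L W ∧ u x₀ < W x₀ := by
  rw [statOp_eq] at hneg
  obtain ⟨κ, hκ, hκ2⟩ := exists_pos_mul_lt (neg_pos.2 hneg) (2 * N)
  set c := u x₀ - φ x₀ with hc
  set ψ : Euc N → ℝ := fun x => φ x + -κ * ‖x - x₀‖ ^ 2 with hψ
  have hψc : ContDiff ℝ 2 ψ := hφ.add (contDiff_const.mul (contDiff_normSq x₀))
  have hψ0 : ψ x₀ = φ x₀ := by simp [hψ]
  set E : Euc N → ℝ := fun x => eikOp m ψ x + lam * (ψ x + c) - f x with hE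
  have hEc : ContinuousWithinAt E (closure Ω) x₀ :=
    ((continuousAt_eikOp (by linarith) hψc.contDiffAt).add (continuousAt_const.mul
      (hψc.continuous.continuousAt.add continuousAt_const))).continuousWithinAt.sub (hf x₀ hx₀)
  have hE0 : E x₀ < 0 := by
    simp only [hE]
    rw [hψ0, hψ, eikOp_add_normSq m hφ.contDiffAt]
    simp only [hc, add_sub_cancel]
    linarith
  obtain ⟨b, hb0, hbR⟩ : ∃ b > 0, ∀ᶠ x in 𝓝 x₀, x ∈ frontier Ω → ψ x + c + b ≤ R := by
    rcases hcase with hx | hx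
    · refine ⟨1, one_pos, ?_⟩
      filter_upwards [hΩ.mem_nhds hx] with x hxΩ hxf
      rw [hΩ.frontier_eq] at hxf
      exact absurd hxΩ hxf.2
    · refine ⟨(R - u x₀) / 2, by linarith, ?_⟩
      have : ContinuousAt (fun x => ψ x + c) x₀ :=
        hψc.continuous.continuousAt.add continuousAt_const
      filter_upwards [this.eventually (gt_mem_nhds (show ψ x₀ + c < (R + u x₀) / 2 by
        rw [hψ0, hc]; linarith))] with x hx _
      linarith
  have hev : ∀ᶠ x in 𝓝 x₀, (x ∈ closure Ω → E x < E x₀ / 2) ∧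
      (x ∈ closure Ω → φ x + c ≤ u x) ∧ (x ∈ frontier Ω → ψ x + c + b ≤ R) := by
    refine (eventually_nhdsWithin_iff.1 (hEc.eventually (gt_mem_nhds (by linarith)))).and
      (Eventually.and ?_ hbR)
    filter_upwards [eventually_nhdsWithin_iff.1 hmin] with x hx hxc
    have := hx hxc
    simp only [Pi.sub_apply] at this
    linarith
  obtain ⟨r, hr, hrb⟩ := Metric.eventually_nhds_iff_ball.1 hev
  obtain ⟨δ, hδ, hδb, hδκ, hδE⟩ : ∃ δ > 0, δ ≤ b ∧ δ < κ * (r / 2) ^ 2 ∧ lam * δ ≤ -E x₀ / 2 := by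
    refine ⟨min b (min (κ * (r / 2) ^ 2 / 2) (-E x₀ / 2 / lam)), ?_, min_le_left _ _, ?_, ?_⟩
    · have : 0 < -E x₀ / 2 / lam := div_pos (by linarith) hl
      positivity
    · refine lt_of_le_of_lt ((min_le_right _ _).trans (min_le_left _ _)) (half_lt_self ?_)
      positivity
    · have := mul_le_mul_of_nonneg_left ((min_le_right b _).trans
        (min_le_right (κ * (r / 2) ^ 2 / 2) (-E x₀ / 2 / lam))) hl.le
      rwa [mul_div_cancel₀ _ hl.ne'] at this
  set Ψ : Euc N → ℝ := fun x => ψ x + (c + δ) with hΨ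
  have hΨc : ContDiff ℝ 2 Ψ := hψc.add contDiff_const
  classical
  set W : Euc N → ℝ := fun x => if x ∈ ball x₀ r then max (u x) (Ψ x) else u x with hW
  have hWin : ∀ x ∈ ball x₀ r, W x = max (u x) (Ψ x) := fun x hx => if_pos hx
  have hWout : ∀ x ∈ closure Ω, r / 2 < ‖x - x₀‖ → W x = u x := by
    intro x hx hxr
    by_cases hxb : x ∈ ball x₀ r
    · rw [hWin x hxb]
      refine max_eq_left ?_
      have i1 := (hrb x hxb).2.1 hx
      have i2 : κ * (r / 2) ^ 2 ≤ κ * ‖x - x₀‖ ^ 2 := by gcongr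
      simp only [hΨ, hψ]
      linarith
    · exact if_neg hxb
  have hfar : IsOpen {x : Euc N | r / 2 < ‖x - x₀‖} := isOpen_lt continuous_const (by fun_prop)
  have hcover : ∀ x : Euc N, x ∈ ball x₀ r ∨ r / 2 < ‖x - x₀‖ := fun x => by
    rw [mem_ball, dist_eq_norm]
    by_contra! hcon
    linarith
  have huW : ∀ x, u x ≤ W x := fun x => by
    simp only [hW]
    split_ifs
    · exact le_max_left _ _
    · exact le_rfl
  refine ⟨W, ⟨?_, ?_, ?_, fun x hx => (hu.le_of_mem_closure x hx).trans (huW x)⟩, ?_⟩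
  · intro x hx
    rcases hcover x with hxb | hxr
    · have hmaxc : ContinuousWithinAt (fun y => max (u y) (Ψ y)) (closure Ω) x :=
        ContinuousWithinAt.sup (hu.continuousOn x hx) hΨc.continuous.continuousWithinAt
      refine hmaxc.congr_of_eventuallyEq ?_ (hWin x hxb)
      filter_upwards [mem_nhdsWithin_of_mem_nhds (isOpen_ball.mem_nhds hxb)] with y hy
      exact hWin y hy
    · refine (hu.continuousOn x hx).congr_of_eventuallyEq ?_ (hWout x hx hxr)
      filter_upwards [mem_nhdsWithin_of_mem_nhds (hfar.mem_nhds hxr), self_mem_nhdsWithin] with y hy hyc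
      exact hWout y hyc hy
  · intro χ hχ x hx hmax
    rw [statOp_eq]
    rcases le_or_gt (W x) (u x) with hWu | hWu
    · have e : W x = u x := le_antisymm hWu (huW x)
      have hmax' : IsLocalMax (fun y => u y - χ y) x := by
        filter_upwards [hmax] with y hy
        linarith [huW y]
      rw [e, ← statOp_eq]
      exact hu.isViscSub χ hχ x hx hmax'
    · have hxb : x ∈ ball x₀ r := by
        by_contra hn
        exact hWu.ne' (if_neg hn)
      have e : W x = Ψ x := by
        rw [hWin x hxb] at hWu ⊢
        exact max_eq_right (not_lt.1 fun hlt => hWu.ne' (max_eq_left hlt.le))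
      have hmax' : IsLocalMax (fun y => Ψ y - χ y) x := by
        filter_upwards [hmax, isOpen_ball.mem_nhds hxb] with y hy hyb
        have := le_max_right (u y) (Ψ y)
        rw [← hWin y hyb] at this
        linarith
      have h1 := eikOp_le_of_isLocalMax_sub (m := m) hΨc.contDiffAt hχ.contDiffAt hmax'
      have h2 : eikOp m Ψ x = eikOp m ψ x := eikOp_add_const m hψc.contDiffAt _
      have h3 := (hrb x hxb).1 (subset_closure hx)
      simp only [hE] at h3 hδE
      rw [e]
      simp only [hΨ] at h1 h2 ⊢
      linarith
  · intro x hx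
    simp only [hW]
    split_ifs with hxb
    · refine max_le (hu.le_of_mem_frontier x hx) ?_
      have := (hrb x hxb).2.2 hx
      simp only [hΨ]
      linarith
    · exact hu.le_of_mem_frontier x hx
  · rw [hWin x₀ (mem_ball_self hr)]
    refine lt_of_lt_of_le ?_ (le_max_right _ _)
    simp only [hΨ, hψ0, hc]
    linarith

lemma IsAdmissible.isStatSub {u : Euc N → ℝ} (hΩ : IsOpen Ω) (hu : IsAdmissible Ω f lam m R L u) :
    IsStatSub Ω f (fun _ => R) lam m u := by
  refine ⟨hu.continuousOn.upperSemicontinuousOn, fun φ hφ x₀ _ hmax => ⟨fun hx => ?_, fun hx => ?_⟩⟩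
  · exact hu.isViscSub φ hφ x₀ hx
      (hmax.isLocalMax (mem_of_superset (hΩ.mem_nhds hx) subset_closure))
  · exact min_le_of_right_le (sub_nonpos.2 (hu.le_of_mem_frontier x₀ hx))

lemma isStatSuper_of_maximal {u : Euc N → ℝ} (hΩ : IsOpen Ω) (hm : 2 < m)
    (hf : ContinuousOn f (closure Ω)) (hl : 0 < lam) (hu : IsAdmissible Ω f lam m R L u)
    (hmax : ∀ w, IsAdmissible Ω f lam m R L w → ∀ x ∈ closure Ω, w x ≤ u x) :
    IsStatSuper Ω f (fun _ => R) lam m u := by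
  have key : ∀ φ : Euc N → ℝ, ContDiff ℝ 2 φ → ∀ x₀ ∈ closure Ω,
      IsLocalMinOn (u - φ) (closure Ω) x₀ → (x₀ ∈ Ω ∨ u x₀ < R) →
        0 ≤ statOp f lam m φ (u x₀) x₀ := by
    intro φ hφ x₀ hx₀ hmin hcase
    by_contra! hneg
    obtain ⟨W, hW, hlt⟩ := hu.exists_bump hΩ hm hf hl hφ hx₀ hmin hcase hneg
    exact absurd (hmax W hW x₀ hx₀) (not_le.2 hlt)
  refine ⟨hu.continuousOn.lowerSemicontinuousOn, fun φ hφ x₀ hx₀ hmin =>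
    ⟨fun hx => key φ hφ x₀ hx₀ hmin (Or.inl hx), fun hx => ?_⟩⟩
  rcases lt_or_ge (u x₀) R with h | h
  · exact le_max_of_le_left (key φ hφ x₀ hx₀ hmin (Or.inr h))
  · exact le_max_of_le_right (sub_nonneg.2 h)

end PerronSupersolution

section Comparison

open scoped ContDiff

variable {N : ℕ} {Ω : Set (Euc N)} {s f : Euc N → ℝ} {lam m R L : ℝ}

lemma IsViscSub.congr (hΩ : IsOpen Ω) {w w' f' : Euc N → ℝ} (hw : IsViscSub Ω f lam m w)
    (hww' : EqOn w w' Ω) (hff' : EqOn f f' Ω) : IsViscSub Ω f' lam m w' := by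
  intro φ hφ x hx hmax
  have h := hw φ hφ x hx (hmax.congr (by
    filter_upwards [hΩ.mem_nhds hx] with y hy
    rw [hww' hy]))
  rwa [statOp, hww' hx, hff' hx] at h

lemma abs_moll_sub_le {w κ : Euc N → ℝ} (hw : LocallyIntegrable w) (hκ : Continuous κ)
    (hκc : HasCompactSupport κ) (hκ0 : ∀ t, 0 ≤ κ t) (hκ1 : ∫ t, κ t = 1) {x : Euc N} {c η : ℝ}
    (h : ∀ t ∈ tsupport κ, |w (x - t) - c| ≤ η) : |moll w κ x - c| ≤ η := by
  have i1 : Integrable fun y => w y * κ (x - y) := integrable_mul_comp_sub hw hκ hκc x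
  have i0 : Integrable fun y => κ (x - y) :=
    (hκ.integrable_of_hasCompactSupport hκc).comp_sub_left x
  have e0 : ∫ y, κ (x - y) = 1 := by rw [integral_sub_left_eq_self κ volume x, hκ1]
  have e1 : moll w κ x - c = ∫ y, (w y - c) * κ (x - y) := by
    simp only [sub_mul]
    rw [integral_sub i1 (i0.const_mul c), integral_const_mul, e0, mul_one, moll]
  have e2 : ∫ y, η * κ (x - y) = η := by rw [integral_const_mul, e0, mul_one]
  rw [e1, ← e2, ← Real.norm_eq_abs]
  refine norm_integral_le_of_norm_le (i0.const_mul η) (Eventually.of_forall fun y => ?_)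
  rw [norm_mul, Real.norm_eq_abs, Real.norm_of_nonneg (hκ0 _)]
  by_cases hy : x - y ∈ tsupport κ
  · have := h _ hy
    rw [sub_sub_cancel] at this
    exact mul_le_mul_of_nonneg_right this (hκ0 _)
  · rw [image_eq_zero_of_notMem_tsupport hy, mul_zero, mul_zero]

/-- Up to the boundary, subsolutions are uniformly approximated by smooth almost subsolutions. -/
lemma IsViscSub.exists_smooth_approx (h : IsDefFun Ω s) (hΩ : IsOpen Ω)
    (hb : Bornology.IsBounded Ω) (hm : 2 < m) (hf : ContinuousOn f (closure Ω)) {w : Euc N → ℝ}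
    (hwc : ContinuousOn w (closure Ω)) (hw : IsViscSub Ω f lam m w) {z : Euc N}
    (hz : z ∈ closure Ω) :
    ∃ r > 0, ∀ η > 0, ∃ U : Euc N → ℝ, ContDiff ℝ 2 U ∧ ∀ x ∈ closure Ω, ‖x - z‖ ≤ r →
      |U x - w x| ≤ η ∧ eikOp m U x + lam * U x ≤ f x + η := by
  obtain ⟨n, hn, r, hr, -, hcone⟩ := h.exists_cone hΩ hz
  refine ⟨r, hr, fun η hη => ?_⟩
  have hcl : IsCompact (closure Ω) := hb.isCompact_closure
  obtain ⟨δ₁, hδ₁, hw1⟩ := Metric.uniformContinuousOn_iff.1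
    (hcl.uniformContinuousOn_of_continuous hwc) η hη
  obtain ⟨δ₂, hδ₂, hf1⟩ := Metric.uniformContinuousOn_iff.1
    (hcl.uniformContinuousOn_of_continuous hf) η hη
  obtain ⟨t, ht, htr, ht1, ht2⟩ : ∃ t > 0, t ≤ r ∧ 2 * t ≤ δ₁ ∧ 2 * t ≤ δ₂ := by
    refine ⟨min r (min (δ₁ / 2) (δ₂ / 2)), by positivity, min_le_left _ _, ?_, ?_⟩
    · linarith [(min_le_right r (min (δ₁ / 2) (δ₂ / 2))).trans (min_le_left _ _)]
    · linarith [(min_le_right r (min (δ₁ / 2) (δ₂ / 2))).trans (min_le_right _ _)]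
  let bump : ContDiffBump (-(t • n) : Euc N) := ⟨t / 16, t / 8, by positivity, by linarith⟩
  set κ : Euc N → ℝ := bump.normed volume with hκdef
  have hκ : ContDiff ℝ ∞ κ := bump.contDiff_normed
  have hκc : HasCompactSupport κ := bump.hasCompactSupport_normed
  have hκ0 : ∀ t, 0 ≤ κ t := fun t => bump.nonneg_normed t
  have hκ1 : ∫ t, κ t = 1 := bump.integral_normed
  have hsupp : ∀ y ∈ tsupport κ, ‖y + t • n‖ ≤ t / 8 := by
    intro y hy
    rw [hκdef, bump.tsupport_normed_eq, mem_closedBall, dist_eq_norm, sub_neg_eq_add] at hy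
    exact hy
  have hmem : ∀ x ∈ closure Ω, ‖x - z‖ ≤ r → ∀ y ∈ tsupport κ, x - y ∈ Ω := by
    intro x hx hxr y hy
    refine hcone x hx hxr t ht htr ?_
    rw [mem_ball, dist_eq_norm, show x - y - (x + t • n) = -(y + t • n) by abel, norm_neg]
    linarith [hsupp y hy]
  have hdist : ∀ x : Euc N, ∀ y ∈ tsupport κ, dist (x - y) x < 2 * t := by
    intro x y hy
    rw [dist_eq_norm, show x - y - x = t • n - (y + t • n) by abel]
    refine (norm_sub_le _ _).trans_lt ?_
    have : ‖t • n‖ ≤ t := by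
      rw [norm_smul, Real.norm_of_nonneg ht.le]
      nlinarith
    linarith [hsupp y hy]
  have hli : ∀ g : Euc N → ℝ, ContinuousOn g (closure Ω) →
      LocallyIntegrable ((closure Ω).indicator g) := fun g hg =>
    ((hg.integrableOn_compact hcl).integrable_indicator
      isClosed_closure.measurableSet).locallyIntegrable
  have heq : ∀ g : Euc N → ℝ, EqOn g ((closure Ω).indicator g) Ω := fun g x hx =>
    (indicator_of_mem (subset_closure hx) g).symm
  refine ⟨moll ((closure Ω).indicator w) κ, (contDiff_moll (hli w hwc) hκ hκc).of_le two_le_infty,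
    fun x hx hxr => ⟨?_, ?_⟩⟩
  · refine abs_moll_sub_le (hli w hwc) hκ.continuous hκc hκ0 hκ1 fun y hy => ?_
    have hy' := hmem x hx hxr y hy
    rw [← heq w hy', ← Real.dist_eq]
    exact (hw1 _ (subset_closure hy') _ hx ((hdist x y hy).trans_le ht1)).le
  · have h1 := (hw.congr hΩ (heq w) (heq f)).eikOp_moll_le hΩ hm
      ((hwc.mono subset_closure).congr (heq w).symm) (hli w hwc)
      ((hf.mono subset_closure).congr (heq f).symm) (hli f hf) hκ hκc hκ0 hκ1 (hmem x hx hxr)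
    have h2 : |moll ((closure Ω).indicator f) κ x - f x| ≤ η := by
      refine abs_moll_sub_le (hli f hf) hκ.continuous hκc hκ0 hκ1 fun y hy => ?_
      have hy' := hmem x hx hxr y hy
      rw [← heq f hy', ← Real.dist_eq]
      exact (hf1 _ (subset_closure hy') _ hx ((hdist x y hy).trans_le ht2)).le
    linarith [(abs_le.1 h2).2]

lemma norm_combo_rpow_le (hm : 2 < m) {a b : ℝ} (ha : 0 ≤ a) (hb : 0 ≤ b) (hab : a + b = 1)
    (p q : Euc N) : ‖a • p + b • q‖ ^ m ≤ a * ‖p‖ ^ m + b * ‖q‖ ^ m := by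
  have h1 : ‖a • p + b • q‖ ≤ a * ‖p‖ + b * ‖q‖ := by
    refine (norm_add_le _ _).trans_eq ?_
    rw [norm_smul, norm_smul, Real.norm_of_nonneg ha, Real.norm_of_nonneg hb]
  refine (Real.rpow_le_rpow (norm_nonneg _) h1 (by linarith)).trans ?_
  exact (convexOn_rpow (by linarith : (1 : ℝ) ≤ m)).2 (norm_nonneg p) (norm_nonneg q) ha hb hab

lemma eikOp_combo_normSq_le (hm : 2 < m) {U : Euc N → ℝ} (hU : ContDiff ℝ 2 U) {ε A r : ℝ}
    (hε : 0 ≤ ε) (hε1 : ε ≤ 1) (hA : 0 ≤ A) {x₀ x : Euc N} (hx : ‖x - x₀‖ ≤ r) :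
    eikOp m (fun x => (1 - ε) * U x - ε * A * ‖x - x₀‖ ^ 2) x ≤
      (1 - ε) * eikOp m U x + ε * (2 * N * A + (2 * A * r) ^ m) := by
  have hn := contDiff_normSq x₀
  have h1 : ContDiffAt ℝ 2 (fun x => (1 - ε) * U x) x := (contDiff_const.mul hU).contDiffAt
  have h2 : ContDiffAt ℝ 2 (fun x => ε * A * ‖x - x₀‖ ^ 2) x := (contDiff_const.mul hn).contDiffAt
  rw [eikOp, lapl_sub h1 h2, gradient_sub h1 h2, lapl_const_mul _ hU.contDiffAt,
    lapl_const_mul _ hn.contDiffAt, lapl_normSq, gradient_const_mul _ hU.contDiffAt,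
    gradient_const_mul _ hn.contDiffAt, gradient_normSq, eikOp]
  have e : (1 - ε) • gradient U x - (ε * A) • (2 : ℝ) • (x - x₀) =
      (1 - ε) • gradient U x + ε • ((-(2 * A)) • (x - x₀)) := by
    rw [smul_smul, smul_smul, sub_eq_add_neg, ← neg_smul]
    congr 2
    ring
  have h3 := norm_combo_rpow_le hm (sub_nonneg.2 hε1) hε (sub_add_cancel 1 ε) (gradient U x)
    ((-(2 * A)) • (x - x₀))
  rw [← e] at h3
  have h4 : ‖(-(2 * A)) • (x - x₀)‖ ^ m ≤ (2 * A * r) ^ m := by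
    refine Real.rpow_le_rpow (norm_nonneg _) ?_ (by linarith)
    rw [norm_smul, norm_neg, Real.norm_of_nonneg (by positivity)]
    gcongr
  nlinarith [mul_le_mul_of_nonneg_left h4 hε]

/-- Comparison between continuous subsolutions and continuous supersolutions. -/
theorem IsAdmissible.le_of_isStatSuper (h : IsDefFun Ω s) (hΩ : IsOpen Ω)
    (hb : Bornology.IsBounded Ω) (hm : 2 < m) (hf : ContinuousOn f (closure Ω)) (hl : 0 < lam)
    {u v : Euc N → ℝ} (hu : IsAdmissible Ω f lam m R L u) (hvc : ContinuousOn v (closure Ω))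
    (hv : IsStatSuper Ω f (fun _ => R) lam m v) : ∀ x ∈ closure Ω, u x ≤ v x := by
  have hcl : IsCompact (closure Ω) := hb.isCompact_closure
  intro x₁ hx₁
  by_contra! hlt
  obtain ⟨x₀, hx₀, hmax⟩ := hcl.exists_isMaxOn ⟨x₁, hx₁⟩ (hu.continuousOn.sub hvc)
  set μ := u x₀ - v x₀ with hμdef
  have hμle : ∀ x ∈ closure Ω, u x - v x ≤ μ := fun x hx => hmax hx
  have hμ : 0 < μ := by linarith [hμle x₁ hx₁]
  obtain ⟨B, hB⟩ := hcl.exists_bound_of_continuousOn hu.continuousOn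
  obtain ⟨F, hF⟩ := hcl.exists_bound_of_continuousOn hf
  simp only [Real.norm_eq_abs] at hB hF
  have hB0 : 0 ≤ B := (abs_nonneg _).trans (hB x₀ hx₀)
  have hF0 : 0 ≤ F := (abs_nonneg _).trans (hF x₀ hx₀)
  obtain ⟨r₁, hr₁, happ⟩ := hu.isViscSub.exists_smooth_approx h hΩ hb hm hf hu.continuousOn hx₀
  have hnear : ∀ᶠ x in 𝓝 x₀, x ∈ closure Ω → x ∈ Ω ∨ v x < R := by
    by_cases hx : x₀ ∈ Ω
    · filter_upwards [hΩ.mem_nhds hx] with x hx _ using Or.inl hx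
    · have hxf : x₀ ∈ frontier Ω := by
        rw [hΩ.frontier_eq]
        exact ⟨hx₀, hx⟩
      have : v x₀ < R := by linarith [hu.le_of_mem_frontier x₀ hxf]
      filter_upwards [eventually_nhdsWithin_iff.1 ((hvc x₀ hx₀).eventually (gt_mem_nhds this))]
        with x hx hxc using Or.inr (hx hxc)
  obtain ⟨r₂, hr₂, hball⟩ := Metric.eventually_nhds_iff_ball.1 hnear
  obtain ⟨r, hr, hrr₁, hrr₂⟩ : ∃ r > 0, r ≤ r₁ ∧ r < r₂ :=
    ⟨min r₁ (r₂ / 2), by positivity, min_le_left _ _,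
      (min_le_right _ _).trans_lt (half_lt_self hr₂)⟩
  set A := (2 * B + 1) / r ^ 2 with hA
  have hA0 : 0 ≤ A := by positivity
  have hAr : A * r ^ 2 = 2 * B + 1 := by
    rw [hA]
    field_simp
  set C := 2 * N * A + (2 * A * r) ^ m with hC
  have hC0 : 0 ≤ C := by positivity
  obtain ⟨ε, hε, hε1, hεμ⟩ : ∃ ε > 0, ε ≤ 1 ∧ (F + C + lam * B + 1 + lam) * ε < lam * μ := by
    obtain ⟨c, hc, hc2⟩ := exists_pos_mul_lt (mul_pos hl hμ) (F + C + lam * B + 1 + lam)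
    refine ⟨min c 1, by positivity, min_le_right _ _, lt_of_le_of_lt ?_ hc2⟩
    gcongr
    exact min_le_left _ _
  obtain ⟨U, hU, hUapp⟩ := happ (ε / 4) (by positivity)
  set φ : Euc N → ℝ := fun x => (1 - ε) * U x - ε * A * ‖x - x₀‖ ^ 2 with hφ
  have hφc : ContDiff ℝ 2 φ :=
    (contDiff_const.mul hU).sub (contDiff_const.mul (contDiff_normSq x₀))
  have hK : IsCompact (closure Ω ∩ closedBall x₀ r) := hcl.inter_right isClosed_closedBall
  obtain ⟨y, ⟨hyc, hyb⟩, hymin⟩ := hK.exists_isMinOn ⟨x₀, hx₀, mem_closedBall_self hr.le⟩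
    ((hvc.mono inter_subset_left).sub hφc.continuous.continuousOn)
  rw [mem_closedBall, dist_eq_norm] at hyb
  have hUy := hUapp y hyc (hyb.trans hrr₁)
  have hUx := (hUapp x₀ hx₀ (by simpa using hr₁.le)).1
  have hmin0 : v y - φ y ≤ v x₀ - φ x₀ := hymin ⟨hx₀, mem_closedBall_self hr.le⟩
  have hφx₀ : v x₀ - φ x₀ ≤ -μ + ε * B + ε / 4 := by
    have e : φ x₀ = (1 - ε) * U x₀ := by simp [hφ]
    have i1 := (abs_le.1 hUx).1
    have i2 := (abs_le.1 (hB x₀ hx₀)).2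
    rw [e]
    nlinarith
  have hyr : ‖y - x₀‖ < r := by
    refine lt_of_le_of_ne hyb fun he => ?_
    have i1 := (abs_le.1 hUy.1).2
    have i2 := (abs_le.1 (hB y hyc)).1
    have i3 := hμle y hyc
    have i4 : φ y = (1 - ε) * U y - ε * (2 * B + 1) := by
      simp only [hφ]
      rw [he, mul_assoc, hAr]
    rw [i4] at hmin0
    nlinarith
  have hymin' : IsLocalMinOn (v - φ) (closure Ω) y := by
    have hmem : ball x₀ r ∈ 𝓝 y := isOpen_ball.mem_nhds (by rwa [mem_ball, dist_eq_norm])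
    filter_upwards [mem_nhdsWithin_of_mem_nhds hmem, self_mem_nhdsWithin] with x hx hxc
    exact hymin ⟨hxc, ball_subset_closedBall hx⟩
  have htest : 0 ≤ statOp f lam m φ (v y) y := by
    have hyn := hball y (by rw [mem_ball, dist_eq_norm]; linarith) hyc
    have hvt := hv.2 φ hφc y hyc hymin'
    by_cases hyΩ : y ∈ Ω
    · exact hvt.1 hyΩ
    · have hyf : y ∈ frontier Ω := by
        rw [hΩ.frontier_eq]
        exact ⟨hyc, hyΩ⟩
      exact (le_max_iff.1 (hvt.2 hyf)).resolve_right
        (not_le.2 (sub_neg.2 (hyn.resolve_left hyΩ)))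
  rw [statOp_eq] at htest
  have hop := eikOp_combo_normSq_le hm hU hε.le hε1 hA0 (x₀ := x₀) hyb
  have hvy : v y ≤ (1 - ε) * U y - μ + ε * B + ε / 4 := by
    have : 0 ≤ ε * A * ‖y - x₀‖ ^ 2 := by positivity
    have e : φ y = (1 - ε) * U y - ε * A * ‖y - x₀‖ ^ 2 := rfl
    linarith
  have i1 := mul_le_mul_of_nonneg_left hUy.2 (sub_nonneg.2 hε1)
  have i2 := mul_le_mul_of_nonneg_left hvy hl.le
  have i3 := mul_le_mul_of_nonneg_left (abs_le.1 (hF y hyc)).1 hε.le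
  have i4 : 0 < lam * ε := mul_pos hl hε
  nlinarith

end Comparison

section BoundaryCondition

variable {N : ℕ} {Ω : Set (Euc N)} {s f : Euc N → ℝ} {lam m R L : ℝ}

lemma IsStatSub.isViscSub {k v : Euc N → ℝ} (hv : IsStatSub Ω f k lam m v) :
    IsViscSub Ω f lam m v := fun φ hφ x hx hmax =>
  (hv.2 φ hφ x (subset_closure hx) (hmax.on _)).1 hx

/-- Continuous subsolutions of the generalized Dirichlet problem satisfy the boundary condition
in the classical sense. -/
lemma IsStatSub.le_of_mem_frontier (h : IsDefFun Ω s) (hΩ : IsOpen Ω) (hb : Bornology.IsBounded Ω)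
    (hm : 2 < m) (hf : ContinuousOn f (closure Ω)) {v : Euc N → ℝ} (hl : 0 < lam)
    (hvc : ContinuousOn v (closure Ω)) (hv : IsStatSub Ω f (fun _ => R) lam m v) :
    ∀ z ∈ frontier Ω, v z ≤ R := by
  have hcl : IsCompact (closure Ω) := hb.isCompact_closure
  intro z hz
  by_contra! hlt
  have hzc : z ∈ closure Ω := frontier_subset_closure hz
  have hsz : s z = 0 := (h.mem_frontier_iff z).1 hz
  obtain ⟨B, hB⟩ := hcl.exists_bound_of_continuousOn hvc
  obtain ⟨F, hF⟩ := hcl.exists_bound_of_continuousOn hf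
  simp only [Real.norm_eq_abs] at hB hF
  have hB0 : 0 ≤ B := (abs_nonneg _).trans (hB z hzc)
  have hF0 : 0 ≤ F := (abs_nonneg _).trans (hF z hzc)
  set g := ‖gradient s z‖ / 2 with hg
  have hgz : 0 < ‖gradient s z‖ := norm_pos_iff.2 (h.gradient_ne z hz)
  have hg0 : 0 < g := by positivity
  set D := lapl s z + 1 with hD
  have hev : ∀ᶠ x in 𝓝 z, (x ∈ closure Ω → R < v x) ∧ g < ‖gradient s x‖ ∧ lapl s x < D := by
    refine (eventually_nhdsWithin_iff.1 ((hvc z hzc).eventually (lt_mem_nhds hlt))).and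
      (Eventually.and ?_ ?_)
    · exact (continuousAt_gradient h.contDiff.contDiffAt).norm.eventually
        (lt_mem_nhds (by linarith))
    · exact (continuousAt_lapl h.contDiff.contDiffAt).eventually (gt_mem_nhds (by linarith))
  obtain ⟨r₀, hr₀, hball⟩ := Metric.eventually_nhds_iff_ball.1 hev
  set r := r₀ / 2 with hr
  have hrpos : 0 < r := by positivity
  set A := (2 * B + 1) / r ^ 2 with hA
  have hA0 : 0 ≤ A := by positivity
  have hAr : A * r ^ 2 = 2 * B + 1 := by
    rw [hA]
    field_simp
  obtain ⟨C, hC1, hCg, hCA, hCD⟩ : ∃ C : ℝ, 1 ≤ C ∧ 1 ≤ C * g / 2 ∧ 2 * A * r ≤ C * g / 2 ∧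
      2 * N * A + lam * B + F < C * (g ^ 2 / 4) - D := by
    have t1 : Tendsto (fun C : ℝ => C * g / 2) atTop atTop :=
      (tendsto_id.atTop_mul_const hg0).atTop_div_const two_pos
    have t2 : Tendsto (fun C : ℝ => C * (g ^ 2 / 4) - D) atTop atTop :=
      tendsto_atTop_add_const_right _ _ (tendsto_id.atTop_mul_const (by positivity))
    exact ((eventually_ge_atTop 1).and ((t1.eventually_ge_atTop 1).and
      ((t1.eventually_ge_atTop _).and (t2.eventually_gt_atTop _)))).exists
  set φ : Euc N → ℝ := fun x => A * ‖x - z‖ ^ 2 + C * s x with hφ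
  have hn := contDiff_normSq z
  have hφc : ContDiff ℝ 2 φ := (contDiff_const.mul hn).add (contDiff_const.mul h.contDiff)
  have hK : IsCompact (closure Ω ∩ closedBall z r) := hcl.inter_right isClosed_closedBall
  obtain ⟨y, ⟨hyc, hyb⟩, hymax⟩ := hK.exists_isMaxOn ⟨z, hzc, mem_closedBall_self hrpos.le⟩
    ((hvc.mono inter_subset_left).sub hφc.continuous.continuousOn)
  rw [mem_closedBall, dist_eq_norm] at hyb
  have hmax0 : v z - φ z ≤ v y - φ y := hymax ⟨hzc, mem_closedBall_self hrpos.le⟩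
  have hφz : φ z = 0 := by simp [hφ, hsz]
  have hyr : ‖y - z‖ < r := by
    refine lt_of_le_of_ne hyb fun he => ?_
    have i1 := (abs_le.1 (hB y hyc)).2
    have i2 := (abs_le.1 (hB z hzc)).1
    have i3 : 0 ≤ C * s y := mul_nonneg (by linarith) ((h.mem_closure_iff y).1 hyc)
    have i4 : φ y = 2 * B + 1 + C * s y := by
      simp only [hφ]
      rw [he, hAr]
    linarith
  have hymax' : IsLocalMaxOn (v - φ) (closure Ω) y := by
    have hmem : ball z r ∈ 𝓝 y := isOpen_ball.mem_nhds (by rwa [mem_ball, dist_eq_norm])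
    filter_upwards [mem_nhdsWithin_of_mem_nhds hmem, self_mem_nhdsWithin] with x hx hxc
    exact hymax ⟨hxc, ball_subset_closedBall hx⟩
  obtain ⟨hvy, hgy, hDy⟩ := hball y (by rw [mem_ball, dist_eq_norm]; linarith)
  have htest : statOp f lam m φ (v y) y ≤ 0 := by
    have hvt := hv.2 φ hφc y hyc hymax'
    by_cases hyΩ : y ∈ Ω
    · exact hvt.1 hyΩ
    · have hyf : y ∈ frontier Ω := by
        rw [hΩ.frontier_eq]
        exact ⟨hyc, hyΩ⟩
      exact (min_le_iff.1 (hvt.2 hyf)).resolve_right (not_le.2 (sub_pos.2 (hvy hyc)))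
  rw [statOp, hφ, lapl_add (contDiff_const.mul hn).contDiffAt
    (contDiff_const.mul h.contDiff).contDiffAt, lapl_const_mul _ hn.contDiffAt,
    lapl_const_mul _ h.contDiff.contDiffAt, lapl_normSq,
    gradient_add (contDiff_const.mul hn).contDiffAt (contDiff_const.mul h.contDiff).contDiffAt,
    gradient_const_mul _ hn.contDiffAt, gradient_const_mul _ h.contDiff.contDiffAt,
    gradient_normSq] at htest
  set G := A • (2 : ℝ) • (y - z) + C • gradient s y with hG
  have hGge : C * g / 2 ≤ ‖G‖ := by
    have e1 : ‖C • gradient s y‖ = C * ‖gradient s y‖ := by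
      rw [norm_smul, Real.norm_of_nonneg (by linarith)]
    have e2 : ‖A • (2 : ℝ) • (y - z)‖ ≤ 2 * A * r := by
      rw [smul_smul, norm_smul, Real.norm_of_nonneg (by positivity), mul_comm A 2]
      gcongr
    have e3 : ‖C • gradient s y‖ ≤ ‖G‖ + ‖A • (2 : ℝ) • (y - z)‖ := by
      rw [show C • gradient s y = G - A • (2 : ℝ) • (y - z) by rw [hG]; abel]
      exact norm_sub_le _ _
    have e4 : C * g ≤ C * ‖gradient s y‖ := mul_le_mul_of_nonneg_left hgy.le (by linarith)
    linarith
  have hGm : (C * g / 2) ^ 2 ≤ ‖G‖ ^ m := by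
    refine (pow_le_pow_left₀ (by positivity) hGge 2).trans ?_
    rw [← Real.rpow_natCast ‖G‖ 2]
    exact Real.rpow_le_rpow_of_exponent_le (hCg.trans hGge) (by exact_mod_cast hm.le)
  have i1 := mul_le_mul_of_nonneg_left (abs_le.1 (hB y hyc)).1 hl.le
  have i2 := (abs_le.1 (hF y hyc)).2
  have i3 : C * lapl s y ≤ C * D := mul_le_mul_of_nonneg_left hDy.le (by linarith)
  have i4 : 0 ≤ 2 * N * A + lam * B + F := by positivity
  nlinarith [mul_le_mul_of_nonneg_right hC1 (i4.trans hCD.le)]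

lemma IsStatSuper.neg_le_of_mem_closure (hΩ : IsOpen Ω) (hb : Bornology.IsBounded Ω) (hm : 2 < m)
    (hR : 0 < R) (hL : 0 ≤ L) (hl : 0 < lam) (hfL : ∀ x ∈ closure Ω, |f x| ≤ lam * L)
    {v : Euc N → ℝ} (hvc : ContinuousOn v (closure Ω))
    (hv : IsStatSuper Ω f (fun _ => R) lam m v) : ∀ x ∈ closure Ω, -L ≤ v x := by
  intro x hx
  obtain ⟨y, hy, hmin⟩ := hb.isCompact_closure.exists_isMinOn ⟨x, hx⟩ hvc
  refine le_trans ?_ (hmin hx)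
  by_contra! hlt
  have hmin' : IsLocalMinOn (v - fun _ => (0 : ℝ)) (closure Ω) y := by
    filter_upwards [self_mem_nhdsWithin] with z hz
    simpa using hmin hz
  have hvt := hv.2 (fun _ => 0) contDiff_const y hy hmin'
  have hneg : statOp f lam m (fun _ => 0) (v y) y < 0 := by
    rw [statOp_eq, eikOp_const hm]
    linarith [(abs_le.1 (hfL y hy)).1, mul_lt_mul_of_pos_left hlt hl]
  by_cases hyΩ : y ∈ Ω
  · exact absurd (hvt.1 hyΩ) (not_le.2 hneg)
  · have hyf : y ∈ frontier Ω := by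
      rw [hΩ.frontier_eq]
      exact ⟨hy, hyΩ⟩
    exact absurd (hvt.2 hyf) (not_le.2 (max_lt hneg (by linarith)))

end BoundaryCondition

/-- Existence, uniqueness and barriers for the stationary
problem with constant boundary data, Lemma 3.4 of the paper. -/
theorem stmt9 {N : ℕ} (hN : 1 ≤ N) (Ω : Set (Euc N))
    (hΩo : IsOpen Ω) (hΩb : Bornology.IsBounded Ω) (hΩc : IsConnected Ω)
    (hΩ2 : HasC2Boundary Ω)
    (m : ℝ) (hm : 2 < m) (f : Euc N → ℝ) (hf : ContinuousOn f (closure Ω)) :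
    ∃ δ₀ > (0 : ℝ), ∃ M > (0 : ℝ), ∃ K > (0 : ℝ),
      ∀ R lam : ℝ, 0 < R → 0 < lam → lam < 1 →
        ∃ u : Euc N → ℝ, ContinuousOn u (closure Ω) ∧
          IsStatSub Ω f (fun _ => R) lam m u ∧
          IsStatSuper Ω f (fun _ => R) lam m u ∧
          (∀ v : Euc N → ℝ, ContinuousOn v (closure Ω) →
            IsStatSub Ω f (fun _ => R) lam m v →
            IsStatSuper Ω f (fun _ => R) lam m v →
            Set.EqOn v u (closure Ω)) ∧
          (∀ x ∈ Ω, -(sSup ((fun y => |f y|) '' closure Ω)) / lam ≤ u x) ∧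
          (∀ x ∈ Ω, u x ≤ K / lam) ∧
          (∀ x ∈ Ω, infDist x (frontier Ω) ≤ δ₀ →
            u x ≤ -(M / ((m - 2) / (m - 1))) *
              infDist x (frontier Ω) ^ ((m - 2) / (m - 1)) + K / lam) := by
  obtain ⟨s, h⟩ := hΩ2.exists_isDefFun
  obtain ⟨M, hM, K, hK, hupper⟩ := h.exists_upper_bound hΩb hm hf
  obtain ⟨c, hc, hdist⟩ := h.exists_mul_infDist_le hΩb
  have hα : 0 < (m - 2) / (m - 1) := div_pos (by linarith) (by linarith)
  set α := (m - 2) / (m - 1) with hαdef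
  refine ⟨1, one_pos, M * c ^ α, by positivity, K, hK, fun R lam hR hl hl1 => ?_⟩
  set F := sSup ((fun y => |f y|) '' closure Ω) with hFdef
  have hFle : ∀ x ∈ closure Ω, |f x| ≤ F := fun x hx =>
    le_csSup (hΩb.isCompact_closure.image_of_continuousOn hf.abs).bddAbove ⟨x, hx, rfl⟩
  have hF0 : 0 ≤ F := by
    obtain ⟨x, hx⟩ := hΩc.nonempty
    exact (abs_nonneg _).trans (hFle x (subset_closure hx))
  have hL : 0 ≤ F / lam := by positivity
  have hfL : ∀ x ∈ closure Ω, |f x| ≤ lam * (F / lam) := fun x hx => by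
    rw [mul_div_cancel₀ _ hl.ne']
    exact hFle x hx
  set u := perron Ω f lam m R (F / lam) with hudef
  have hu : IsAdmissible Ω f lam m R (F / lam) u :=
    isAdmissible_perron h hΩo hΩb hm hf hl hl1 hR hL hfL
  have hmax : ∀ w, IsAdmissible Ω f lam m R (F / lam) w → ∀ x ∈ closure Ω, w x ≤ u x :=
    fun w hw x hx => hw.le_perron h hΩb hm hf hl hl1 hx
  have hub := hupper lam hl hl1 u hu.continuousOn hu.isViscSub
  refine ⟨u, hu.continuousOn, hu.isStatSub hΩo, isStatSuper_of_maximal hΩo hm hf hl hu hmax,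
    fun v hvc hvsub hvsup x hx => le_antisymm ?_ ?_, fun x hx => ?_, fun x hx => ?_,
    fun x hx _ => ?_⟩
  · exact hmax v ⟨hvc, hvsub.isViscSub, hvsub.le_of_mem_frontier h hΩo hΩb hm hf hl hvc,
      hvsup.neg_le_of_mem_closure hΩo hΩb hm hR hL hl hfL hvc⟩ x hx
  · exact hu.le_of_isStatSuper h hΩo hΩb hm hf hl hvc hvsup x hx
  · rw [neg_div]
    exact hu.le_of_mem_closure x (subset_closure hx)
  · have : 0 ≤ M / α * s x ^ α :=
      mul_nonneg (by positivity) (Real.rpow_nonneg ((h.mem_closure_iff x).1 (subset_closure hx)) _)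
    linarith [hub x hx]
  · have h1 : (c * infDist x (frontier Ω)) ^ α ≤ s x ^ α :=
      Real.rpow_le_rpow (mul_nonneg hc.le infDist_nonneg) (hdist x hx) hα.le
    rw [Real.mul_rpow hc.le infDist_nonneg] at h1
    have h2 := mul_le_mul_of_nonneg_left h1 (show 0 ≤ M / α by positivity)
    have h3 : M * c ^ α / α * infDist x (frontier Ω) ^ α =
        M / α * (c ^ α * infDist x (frontier Ω) ^ α) := by ring
    linarith [hub x hx]
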